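/- (Auslander–Bridger formula for coherent rings) Let R be a quasi-local coherent ring and M a nonzero finitely presented R-module of finite G-dimension. Then depth M + Gdim_R M = depth R. -/

import Mathlib

open CategoryTheory Opposite TensorProduct

universe u

namespace AB

/-- `M` is `(FP)ₙ`: there is an exact sequence `Fₙ → ⋯ → F₀ → M → 0`
with each `Fᵢ` finitely generated free.  Equivalently (the form used here),
`(FP)₀` means finitely generated, and `M` is `(FP)_{n+1}` iff there is a
surjection from a finitely generated free module whose kernel is `(FP)ₙ`. -/
def IsFP (R : Type u) [CommRing R] : ℕ → ModuleCat.{u} R → Prop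
  | 0, M => Module.Finite R M
  | n + 1, M => ∃ (k : ℕ) (f : (Fin k → R) →ₗ[R] M), Function.Surjective f ∧
      IsFP R n (ModuleCat.of R (LinearMap.ker f))

/-- `M` is `(FP)_∞`. -/
def IsFPInf (R : Type u) [CommRing R] (M : ModuleCat.{u} R) : Prop := ∀ n, IsFP R n M

/-- `Ext^i_R(M, N)` as a type. -/
noncomputable abbrev ext (R : Type u) [CommRing R] (M N : ModuleCat.{u} R) (i : ℕ) :=
  ((Ext R (ModuleCat.{u} R) i).obj (op M)).obj N

/-- `Ext^i_R(M, N) = 0`. -/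
def extZero (R : Type u) [CommRing R] (M N : ModuleCat.{u} R) (i : ℕ) : Prop :=
  Subsingleton (ext R M N i)

/-- membership in the G-class `G(R)`. -/
def MemG (R : Type u) [CommRing R] (M : ModuleCat.{u} R) : Prop :=
  Module.Finite R M ∧ Module.IsReflexive R M ∧
    (∀ i > 0, extZero R M (ModuleCat.of R R) i) ∧
    (∀ i > 0, extZero R (ModuleCat.of R (Module.Dual R M)) (ModuleCat.of R R) i)

/-- membership in the restricted G-class `G̃(R)`. -/
def MemGtilde (R : Type u) [CommRing R] (M : ModuleCat.{u} R) : Prop :=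
  MemG R M ∧ IsFPInf R M ∧ IsFPInf R (ModuleCat.of R (Module.Dual R M))

/-- `Gdim_R M ≤ n`. -/
def GDimLe (R : Type u) [CommRing R] : ℕ → ModuleCat.{u} R → Prop
  | 0, M => MemG R M
  | n + 1, M => ∃ (G : ModuleCat.{u} R) (f : G →ₗ[R] M), MemG R G ∧ Function.Surjective f ∧
      GDimLe R n (ModuleCat.of R (LinearMap.ker f))

/-- `G̃dim_R M ≤ n`. -/
def GtildeDimLe (R : Type u) [CommRing R] : ℕ → ModuleCat.{u} R → Prop
  | 0, M => MemGtilde R M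
  | n + 1, M => ∃ (G : ModuleCat.{u} R) (f : G →ₗ[R] M), MemGtilde R G ∧ Function.Surjective f ∧
      GtildeDimLe R n (ModuleCat.of R (LinearMap.ker f))

/-- `pd_R M ≤ n`. -/
def ProjDimLe (R : Type u) [CommRing R] : ℕ → ModuleCat.{u} R → Prop
  | 0, M => Module.Projective R M
  | n + 1, M => ∃ (P : ModuleCat.{u} R) (f : P →ₗ[R] M), Module.Projective R P ∧
      Function.Surjective f ∧ ProjDimLe R n (ModuleCat.of R (LinearMap.ker f))

/-- The G-dimension of `M`, as an element of `ℕ∞` (`⊤` meaning `Gdim` is infinite/undefined). -/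
noncomputable def GDim (R : Type u) [CommRing R] (M : ModuleCat.{u} R) : ℕ∞ :=
  sInf {n : ℕ∞ | ∃ m : ℕ, n = m ∧ GDimLe R m M}

/-- The restricted G-dimension of `M`, as an element of `ℕ∞`. -/
noncomputable def GtildeDim (R : Type u) [CommRing R] (M : ModuleCat.{u} R) : ℕ∞ :=
  sInf {n : ℕ∞ | ∃ m : ℕ, n = m ∧ GtildeDimLe R m M}

/-- The projective dimension of `M`, as an element of `ℕ∞`. -/
noncomputable def ProjDim (R : Type u) [CommRing R] (M : ModuleCat.{u} R) : ℕ∞ :=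
  sInf {n : ℕ∞ | ∃ m : ℕ, n = m ∧ ProjDimLe R m M}

/-- The classical depth of `N` with respect to the ideal `I`: the supremum of the
lengths of regular sequences on `N` contained in `I`. -/
noncomputable def cdepth (S : Type u) [CommRing S] (I : Ideal S) (N : Type u)
    [AddCommGroup N] [Module S N] : ℕ∞ :=
  ⨆ rs : {l : List S // (∀ r ∈ l, r ∈ I) ∧ RingTheory.Sequence.IsRegular N l},
    (rs.1.length : ℕ∞)

/-- A bundled faithfully flat (commutative) algebra extension of `R`. -/
structure FFExt (R : Type u) [CommRing R] where
  S : Type u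
  [ring : CommRing S]
  [alg : Algebra R S]
  faithfullyFlat : Module.FaithfullyFlat R S

attribute [instance] FFExt.ring FFExt.alg

/-- The depth of a module `M` over a quasi-local ring `R`: the supremum, over all
faithfully flat extensions `S` of `R`, of the classical depth of `M ⊗_R S` with
respect to `mS`. -/
noncomputable def depth (R : Type u) [CommRing R] [IsLocalRing R] (M : Type u)
    [AddCommGroup M] [Module R M] : ℕ∞ :=
  ⨆ E : FFExt R,
    cdepth E.S (Ideal.map (algebraMap R E.S) (IsLocalRing.maximalIdeal R))
      (TensorProduct R E.S M)

end AB

namespace AB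

section ExtModule

variable {R : Type u} [CommRing R]

variable (R) in
/-- `Ext^i_R(T, N)` for unbundled modules, as a Yoneda `Ext` group. -/
abbrev ExtGrp (T N : Type u) [AddCommGroup T] [Module R T] [AddCommGroup N] [Module R N] (i : ℕ) :=
  Abelian.Ext.{u} (ModuleCat.of R T) (ModuleCat.of R N) i

variable {T T' T'' N N' N'' A B C : Type u}
  [AddCommGroup T] [Module R T] [AddCommGroup T'] [Module R T'] [AddCommGroup T''] [Module R T'']
  [AddCommGroup N] [Module R N] [AddCommGroup N'] [Module R N'] [AddCommGroup N''] [Module R N'']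
  [AddCommGroup A] [Module R A] [AddCommGroup B] [Module R B] [AddCommGroup C] [Module R C]
  {i : ℕ}

/-- Covariant functoriality of `Ext^i_R(T, -)`. -/
noncomputable def push (f : N →ₗ[R] N') : ExtGrp R T N i →ₗ[R] ExtGrp R T N' i where
  toFun x := x.comp (Abelian.Ext.mk₀ (ModuleCat.ofHom f)) (add_zero i)
  map_add' x y := by simp
  map_smul' r x := by simp

/-- Contravariant functoriality of `Ext^i_R(-, N)`. -/
noncomputable def pull (f : T →ₗ[R] T') : ExtGrp R T' N i →ₗ[R] ExtGrp R T N i where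
  toFun x := (Abelian.Ext.mk₀ (ModuleCat.ofHom f)).comp x (zero_add i)
  map_add' x y := by simp
  map_smul' r x := by simp

lemma push_push (f : N →ₗ[R] N') (g : N' →ₗ[R] N'') (x : ExtGrp R T N i) :
    push g (push f x) = push (g ∘ₗ f) x := by
  simp only [push, LinearMap.coe_mk, AddHom.coe_mk]
  rw [Abelian.Ext.comp_assoc_of_third_deg_zero, Abelian.Ext.mk₀_comp_mk₀, ModuleCat.ofHom_comp]

lemma pull_pull (f : T →ₗ[R] T') (g : T' →ₗ[R] T'') (x : ExtGrp R T'' N i) :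
    pull f (pull g x) = pull (g ∘ₗ f) x := by
  simp only [pull, LinearMap.coe_mk, AddHom.coe_mk]
  rw [Abelian.Ext.mk₀_comp_mk₀_assoc, ModuleCat.ofHom_comp]

lemma push_id (x : ExtGrp R T N i) : push (LinearMap.id : N →ₗ[R] N) x = x := by
  simp [push]

lemma pull_id (x : ExtGrp R T N i) : pull (LinearMap.id : T →ₗ[R] T) x = x := by
  simp [pull]

lemma push_add (f g : N →ₗ[R] N') (x : ExtGrp R T N i) :
    push (f + g) x = push f x + push g x := by
  simp [push, ModuleCat.ofHom_add, Abelian.Ext.mk₀_add]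

lemma push_zero (x : ExtGrp R T N i) : push (0 : N →ₗ[R] N') x = 0 := by
  simp [push, ModuleCat.ofHom_zero]

lemma push_smul (r : R) (f : N →ₗ[R] N') (x : ExtGrp R T N i) :
    push (r • f) x = r • push f x := by
  have : ModuleCat.ofHom (r • f) = r • ModuleCat.ofHom f := rfl
  simp [push, this, Abelian.Ext.mk₀_smul]

lemma pull_add (f g : T →ₗ[R] T') (x : ExtGrp R T' N i) :
    pull (f + g) x = pull f x + pull g x := by
  simp [pull, ModuleCat.ofHom_add, Abelian.Ext.mk₀_add]

lemma pull_zero (x : ExtGrp R T' N i) : pull (0 : T →ₗ[R] T') x = 0 := by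
  simp [pull, ModuleCat.ofHom_zero]

lemma pull_smul (r : R) (f : T →ₗ[R] T') (x : ExtGrp R T' N i) :
    pull (r • f) x = r • pull f x := by
  have : ModuleCat.ofHom (r • f) = r • ModuleCat.ofHom f := rfl
  simp [pull, this, Abelian.Ext.mk₀_smul]

variable (T N i) in
/-- `push` as a linear map in the homomorphism. -/
noncomputable def pushHom (x : ExtGrp R T N i) : (N →ₗ[R] N') →ₗ[R] ExtGrp R T N' i where
  toFun f := push f x
  map_add' f g := push_add f g x
  map_smul' r f := push_smul r f x

lemma push_sum {ι : Type*} (s : Finset ι) (f : ι → N →ₗ[R] N') (x : ExtGrp R T N i) :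
    push (∑ j ∈ s, f j) x = ∑ j ∈ s, push (f j) x :=
  map_sum (pushHom T N i x) f s

lemma pull_sum {ι : Type*} (s : Finset ι) (f : ι → T →ₗ[R] T') (x : ExtGrp R T' N i) :
    pull (∑ j ∈ s, f j) x = ∑ j ∈ s, pull (f j) x := by
  classical
  induction s using Finset.induction_on with
  | empty => simp [pull_zero]
  | insert a s ha ih => rw [Finset.sum_insert ha, Finset.sum_insert ha, pull_add, ih]

lemma push_surjective_of_equiv (e : N ≃ₗ[R] N') :
    Function.Surjective (push e.toLinearMap : ExtGrp R T N i →ₗ[R] ExtGrp R T N' i) := fun x =>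
  ⟨push e.symm.toLinearMap x, by rw [push_push]; simp [push_id]⟩

lemma pull_surjective_of_equiv (e : T ≃ₗ[R] T') :
    Function.Surjective (pull e.toLinearMap : ExtGrp R T' N i →ₗ[R] ExtGrp R T N i) := fun x =>
  ⟨pull e.symm.toLinearMap x, by rw [pull_pull]; simp [pull_id]⟩

lemma subsingleton_ext_right (e : N ≃ₗ[R] N') [Subsingleton (ExtGrp R T N i)] :
    Subsingleton (ExtGrp R T N' i) :=
  (push_surjective_of_equiv e).subsingleton

lemma subsingleton_ext_left (e : T ≃ₗ[R] T') [Subsingleton (ExtGrp R T' N i)] :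
    Subsingleton (ExtGrp R T N i) :=
  (pull_surjective_of_equiv e).subsingleton

lemma subsingleton_ext_of_projective [Module.Projective R T] (i : ℕ) :
    Subsingleton (ExtGrp R T N (i + 1)) :=
  Abelian.Ext.subsingleton_of_projective (P := ModuleCat.of R T) (ModuleCat.of R N) i

lemma subsingleton_ext_zero_iff :
    Subsingleton (ExtGrp R T N 0) ↔ Subsingleton (T →ₗ[R] N) := by
  refine (Abelian.Ext.homEquiv₀.trans ModuleCat.homEquiv).subsingleton_congr

lemma smul_eq_zero_of_smul_left (r : R) (h : ∀ t : T, r • t = 0) (x : ExtGrp R T N i) :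
    r • x = 0 := by
  have : r • (LinearMap.id : T →ₗ[R] T) = 0 := LinearMap.ext fun t => by simp [h]
  rw [← pull_id x, ← pull_smul, this, pull_zero]

lemma subsingleton_ext_pi_right (n : ℕ) [Subsingleton (ExtGrp R T N i)] :
    Subsingleton (ExtGrp R T (Fin n → N) i) := by
  refine subsingleton_of_forall_eq 0 fun x => ?_
  have : (LinearMap.id : (Fin n → N) →ₗ[R] (Fin n → N)) =
      ∑ j, LinearMap.single R (fun _ => N) j ∘ₗ LinearMap.proj j := by
    ext; simp
  rw [← push_id x, this, push_sum]
  refine Finset.sum_eq_zero fun j _ => ?_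
  rw [← push_push, Subsingleton.elim (push (LinearMap.proj j) x) 0, map_zero]

lemma subsingleton_ext_pi_left (n : ℕ) [Subsingleton (ExtGrp R T N i)] :
    Subsingleton (ExtGrp R (Fin n → T) N i) := by
  refine subsingleton_of_forall_eq 0 fun x => ?_
  have : (LinearMap.id : (Fin n → T) →ₗ[R] (Fin n → T)) =
      ∑ j, LinearMap.single R (fun _ => T) j ∘ₗ LinearMap.proj j := by
    ext; simp
  rw [← pull_id x, this, pull_sum]
  refine Finset.sum_eq_zero fun j _ => ?_
  rw [← pull_pull, Subsingleton.elim (pull (LinearMap.single R (fun _ => T) j) x) 0, map_zero]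

section ShortExact

variable {f : A →ₗ[R] B} {g : B →ₗ[R] C}

lemma shortExact_mk (hf : Function.Injective f) (hfg : Function.Exact f g)
    (hg : Function.Surjective g) :
    (ShortComplex.mk (ModuleCat.ofHom f) (ModuleCat.ofHom g)
      (by rw [← ModuleCat.ofHom_comp, hfg.linearMap_comp_eq_zero]; rfl)).ShortExact where
  exact := (ShortComplex.ShortExact.moduleCat_exact_iff_function_exact _).2 hfg
  mono_f := (ModuleCat.mono_iff_injective _).2 hf
  epi_g := (ModuleCat.epi_iff_surjective _).2 hg

variable (hf : Function.Injective f) (hfg : Function.Exact f g) (hg : Function.Surjective g)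
include hf hfg hg

lemma exists_push_eq (x : ExtGrp R T B i) (hx : push g x = 0) :
    ∃ y : ExtGrp R T A i, push f y = x :=
  Abelian.Ext.covariant_sequence_exact₂ _ (shortExact_mk hf hfg hg) x hx

lemma exists_pull_eq (x : ExtGrp R B N i) (hx : pull f x = 0) :
    ∃ y : ExtGrp R C N i, pull g y = x :=
  Abelian.Ext.contravariant_sequence_exact₂ (shortExact_mk hf hfg hg) _ x hx

lemma push_injective (h : ∀ j, j + 1 = i → Subsingleton (ExtGrp R T C j)) :
    Function.Injective (push f : ExtGrp R T A i →ₗ[R] ExtGrp R T B i) := by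
  cases i with
  | zero =>
    have : Mono (ModuleCat.ofHom f) := (ModuleCat.mono_iff_injective _).2 hf
    exact Abelian.Ext.postcomp_mk₀_injective_of_mono _ (ModuleCat.ofHom f)
  | succ j =>
    have := h j rfl
    rw [injective_iff_map_eq_zero]
    intro x hx
    obtain ⟨y, rfl⟩ := Abelian.Ext.covariant_sequence_exact₁ _ (shortExact_mk hf hfg hg) x hx
      (n₀ := j) rfl
    rw [Subsingleton.elim (α := ExtGrp R T C j) y 0, Abelian.Ext.zero_comp]

lemma pull_injective (h : ∀ j, j + 1 = i → Subsingleton (ExtGrp R A N j)) :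
    Function.Injective (pull g : ExtGrp R C N i →ₗ[R] ExtGrp R B N i) := by
  cases i with
  | zero =>
    have : Epi (ModuleCat.ofHom g) := (ModuleCat.epi_iff_surjective _).2 hg
    exact Abelian.Ext.precomp_mk₀_injective_of_epi _ (ModuleCat.ofHom g)
  | succ j =>
    have := h j rfl
    rw [injective_iff_map_eq_zero]
    intro x hx
    obtain ⟨y, rfl⟩ := Abelian.Ext.contravariant_sequence_exact₃ (shortExact_mk hf hfg hg) _ x hx
      (n₀ := j) (add_comm _ _)
    rw [Subsingleton.elim (α := ExtGrp R A N j) y 0, Abelian.Ext.comp_zero]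

lemma subsingleton_push_left (h : ∀ j, j + 1 = i → Subsingleton (ExtGrp R T C j))
    (hB : Subsingleton (ExtGrp R T B i)) : Subsingleton (ExtGrp R T A i) :=
  (push_injective hf hfg hg h).subsingleton

lemma subsingleton_push_right (hB : Subsingleton (ExtGrp R T B i))
    (hA : Subsingleton (ExtGrp R T A (i + 1))) : Subsingleton (ExtGrp R T C i) := by
  refine subsingleton_of_forall_eq 0 fun x => ?_
  obtain ⟨y, rfl⟩ := Abelian.Ext.covariant_sequence_exact₃ _ (shortExact_mk hf hfg hg) x rfl
    (Subsingleton.elim (α := ExtGrp R T A (i + 1)) _ _)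
  rw [Subsingleton.elim (α := ExtGrp R T B i) y 0, Abelian.Ext.zero_comp]

lemma subsingleton_pull_right (h : ∀ j, j + 1 = i → Subsingleton (ExtGrp R A N j))
    (hB : Subsingleton (ExtGrp R B N i)) : Subsingleton (ExtGrp R C N i) :=
  (pull_injective hf hfg hg h).subsingleton

lemma subsingleton_pull_left (hB : Subsingleton (ExtGrp R B N i))
    (hC : Subsingleton (ExtGrp R C N (i + 1))) : Subsingleton (ExtGrp R A N i) := by
  refine subsingleton_of_forall_eq 0 fun x => ?_
  obtain ⟨y, rfl⟩ := Abelian.Ext.contravariant_sequence_exact₁ (shortExact_mk hf hfg hg) _ x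
    (add_comm _ _) (Subsingleton.elim (α := ExtGrp R C N (i + 1)) _ _)
  rw [Subsingleton.elim (α := ExtGrp R B N i) y 0, Abelian.Ext.comp_zero]

lemma subsingleton_pull_mid (hA : Subsingleton (ExtGrp R A N i))
    (hC : Subsingleton (ExtGrp R C N i)) : Subsingleton (ExtGrp R B N i) := by
  refine subsingleton_of_forall_eq 0 fun x => ?_
  obtain ⟨y, rfl⟩ := exists_pull_eq hf hfg hg x (Subsingleton.elim _ _)
  rw [Subsingleton.elim y 0, map_zero]

lemma exists_extension (h : Subsingleton (ExtGrp R C N 1)) (φ : A →ₗ[R] N) :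
    ∃ ψ : B →ₗ[R] N, ψ ∘ₗ f = φ := by
  obtain ⟨y, hy⟩ := Abelian.Ext.contravariant_sequence_exact₁ (shortExact_mk hf hfg hg) _
    (Abelian.Ext.mk₀ (ModuleCat.ofHom φ)) (add_zero 1)
    (Subsingleton.elim (α := ExtGrp R C N 1) _ _)
  obtain ⟨ψ, rfl⟩ := (Abelian.Ext.mk₀_bijective _ _).2 y
  refine ⟨ψ.hom, ?_⟩
  rw [Abelian.Ext.mk₀_comp_mk₀] at hy
  exact congrArg ModuleCat.Hom.hom ((Abelian.Ext.mk₀_bijective _ _).1 hy)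

lemma subsingleton_ext_one (hB : Subsingleton (ExtGrp R B N 1))
    (h : ∀ φ : A →ₗ[R] N, ∃ ψ : B →ₗ[R] N, ψ ∘ₗ f = φ) : Subsingleton (ExtGrp R C N 1) := by
  refine subsingleton_of_forall_eq 0 fun x => ?_
  obtain ⟨y, rfl⟩ := Abelian.Ext.contravariant_sequence_exact₃ (shortExact_mk hf hfg hg) _ x
    (Subsingleton.elim (α := ExtGrp R B N 1) _ _) (n₀ := 0) rfl
  obtain ⟨φ, rfl⟩ := (Abelian.Ext.mk₀_bijective _ _).2 y
  obtain ⟨ψ, hψ⟩ := h φ.hom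
  have : φ = ModuleCat.ofHom f ≫ ModuleCat.ofHom ψ := ModuleCat.hom_ext hψ.symm
  rw [this, ← Abelian.Ext.mk₀_comp_mk₀]
  exact (shortExact_mk hf hfg hg).extClass_comp_assoc _

end ShortExact

lemma extZero_iff (M N : Type u) [AddCommGroup M] [Module R M] [AddCommGroup N] [Module R N]
    (i : ℕ) : extZero R (ModuleCat.of R M) (ModuleCat.of R N) (i + 1) ↔
      Subsingleton (ExtGrp R M N (i + 1)) := by
  let P := projectiveResolution (ModuleCat.of R M)
  have h1 : extZero R (ModuleCat.of R M) (ModuleCat.of R N) (i + 1) ↔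
      Limits.IsZero (((Ext R (ModuleCat.{u} R) (i + 1)).obj (op (ModuleCat.of R M))).obj
        (ModuleCat.of R N)) := ModuleCat.isZero_iff_subsingleton.symm
  rw [h1, (P.isoExt (R := R) (i + 1) (ModuleCat.of R N)).isZero_iff,
    ← HomologicalComplex.exactAt_iff_isZero_homology,
    HomologicalComplex.exactAt_iff' _ i (i + 1) (i + 2) (by simp) (by simp),
    ShortComplex.ShortExact.moduleCat_exact_iff_function_exact]
  have key : ∀ φ : P.complex.X (i + 1) ⟶ ModuleCat.of R N,
      (P.complex.d (i + 2) (i + 1) ≫ φ = 0 →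
        ∃ g : P.complex.X i ⟶ ModuleCat.of R N, P.complex.d (i + 1) i ≫ g = φ) ↔
      (∀ h : P.complex.d (i + 2) (i + 1) ≫ φ = 0, P.extMk φ (i + 2) rfl h = 0) := fun φ =>
    forall_congr' fun h => (P.extMk_eq_zero_iff φ (i + 2) rfl h i rfl).symm
  constructor
  · intro h
    refine subsingleton_of_forall_eq 0 fun x => ?_
    obtain ⟨φ, hφ, rfl⟩ := P.extMk_surjective x (i + 2) rfl
    exact (key φ).1 (fun h' => (h φ).1 h') hφ
  · intro h φ
    refine ⟨fun h' => (key φ).2 (fun _ => Subsingleton.elim _ _) h', ?_⟩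
    rintro ⟨g, rfl⟩
    have hd : ∀ g' : P.complex.X i ⟶ ModuleCat.of R N,
        P.complex.d (i + 2) (i + 1) ≫ P.complex.d (i + 1) i ≫ g' = 0 := fun g' => by
      rw [← Category.assoc, P.complex.d_comp_d, Limits.zero_comp]
    exact hd g

end ExtModule

section ExactPieces

variable {R : Type*} [CommRing R] {A B C N : Type*} [AddCommGroup A] [Module R A]
  [AddCommGroup B] [Module R B] [AddCommGroup C] [Module R C] [AddCommGroup N] [Module R N]
  {f : A →ₗ[R] B} {g : B →ₗ[R] C}

lemma exists_desc (hfg : Function.Exact f g) (hg : Function.Surjective g) (φ : B →ₗ[R] N)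
    (h : φ ∘ₗ f = 0) : ∃ ψ : C →ₗ[R] N, ψ ∘ₗ g = φ := by
  let e := g.quotKerEquivOfSurjective hg
  refine ⟨(LinearMap.ker g).liftQ φ ?_ ∘ₗ e.symm.toLinearMap, ?_⟩
  · intro x hx
    obtain ⟨y, rfl⟩ := (hfg x).1 hx
    exact LinearMap.congr_fun h y
  · ext x
    have : e.symm (g x) = Submodule.Quotient.mk x := by
      rw [LinearEquiv.symm_apply_eq]; rfl
    simp [this]

lemma exact_dualMap (hfg : Function.Exact f g) (hg : Function.Surjective g) :
    Function.Exact g.dualMap f.dualMap := by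
  intro φ
  constructor
  · intro h
    obtain ⟨ψ, hψ⟩ := exists_desc hfg hg φ h
    exact ⟨ψ, hψ⟩
  · rintro ⟨ψ, rfl⟩
    ext x
    simp [hfg.apply_apply_eq_zero]

lemma exact_subtype_ker (g : B →ₗ[R] C) : Function.Exact (LinearMap.ker g).subtype g := by
  intro x; simp

lemma finite_mid (hfg : Function.Exact f g) (hg : Function.Surjective g)
    [Module.Finite R A] [Module.Finite R C] : Module.Finite R B := by
  refine ⟨Submodule.fg_of_fg_map_of_fg_inf_ker g ?_ ?_⟩
  · rw [Submodule.map_top, LinearMap.range_eq_top.2 hg]; exact Module.Finite.fg_top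
  · rw [top_inf_eq, hfg.linearMap_ker_eq, ← Submodule.map_top]
    exact Module.Finite.fg_top.map f

/-- The kernel of an exact pair, as an equivalence. -/
noncomputable def kerEquiv (hf : Function.Injective f) (hfg : Function.Exact f g) :
    A ≃ₗ[R] LinearMap.ker g :=
  (LinearEquiv.ofInjective f hf).trans (LinearEquiv.ofEq _ _ hfg.linearMap_ker_eq.symm)

end ExactPieces

section Coherent

/-- Every finitely generated ideal is finitely presented. -/
def IsCoh (R : Type u) [CommRing R] : Prop :=
  ∀ I : Ideal R, I.FG → Module.FinitePresentation R I

variable {R : Type u} [CommRing R]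

lemma fp_of_injective_pi (hR : IsCoh R) (n : ℕ) {K : Type u} [AddCommGroup K] [Module R K]
    [Module.Finite R K] (f : K →ₗ[R] (Fin n → R)) (hf : Function.Injective f) :
    Module.FinitePresentation R K := by
  induction n generalizing K with
  | zero =>
    have : Subsingleton K := hf.subsingleton
    infer_instance
  | succ n ih =>
    let p : K →ₗ[R] R := LinearMap.proj 0 ∘ₗ f
    have hfg : (LinearMap.range p).FG := by
      rw [LinearMap.range_eq_map]; exact Module.Finite.fg_top.map p
    have h1 : Module.FinitePresentation R (LinearMap.range p) := hR _ hfg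
    have h2 : Module.Finite R (LinearMap.ker p.rangeRestrict) :=
      Module.Finite.iff_fg.2
        (Module.FinitePresentation.fg_ker p.rangeRestrict p.surjective_rangeRestrict)
    have h3 : Module.FinitePresentation R (LinearMap.ker p.rangeRestrict) := by
      refine ih (LinearMap.funLeft R R Fin.succ ∘ₗ f ∘ₗ Submodule.subtype _) ?_
      rw [injective_iff_map_eq_zero]
      rintro ⟨x, hx⟩ h
      have h0 : f x 0 = 0 := by
        rw [LinearMap.ker_rangeRestrict] at hx; exact hx
      have : f x = 0 := by
        ext j
        refine Fin.cases h0 (fun j => ?_) j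
        exact congrFun h j
      exact Subtype.ext (hf (by simpa using this))
    exact Module.finitePresentation_of_ker p.rangeRestrict p.surjective_rangeRestrict

/-- Over a coherent ring, finitely generated submodules of finitely presented modules are
finitely presented. -/
lemma fp_of_injective (hR : IsCoh R) {K M : Type u} [AddCommGroup K] [Module R K]
    [AddCommGroup M] [Module R M] [Module.Finite R K] [Module.FinitePresentation R M]
    (f : K →ₗ[R] M) (hf : Function.Injective f) : Module.FinitePresentation R K := by
  obtain ⟨n, g, hg⟩ := Module.Finite.exists_fin' R M
  have hk : Module.Finite R (LinearMap.ker g) :=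
    Module.Finite.iff_fg.2 (Module.FinitePresentation.fg_ker g hg)
  let P := (LinearMap.range f).comap g
  let q : P →ₗ[R] LinearMap.range f := g.restrict fun _ hx => hx
  have hq : Function.Surjective q := by
    rintro ⟨y, hy⟩
    obtain ⟨x, rfl⟩ := hg y
    exact ⟨⟨x, hy⟩, rfl⟩
  let j : LinearMap.ker g →ₗ[R] P := Submodule.inclusion fun x hx => by
    have : g x = 0 := hx
    simp [P, this]
  have hjq : Function.Exact j q := by
    rintro ⟨x, hx⟩
    constructor
    · intro h; exact ⟨⟨x, congrArg Subtype.val h⟩, rfl⟩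
    · rintro ⟨y, hy⟩
      have : g y = 0 := y.2
      rw [← hy]; exact Subtype.ext this
  have hP : Module.Finite R P := finite_mid hjq hq
  have hP' := fp_of_injective_pi hR n P.subtype Subtype.val_injective
  have := Module.finitePresentation_of_surjective q hq (by
    rw [hjq.linearMap_ker_eq, ← Submodule.map_top]; exact Module.Finite.fg_top.map j)
  exact Module.FinitePresentation.of_equiv (LinearEquiv.ofInjective f hf).symm

lemma fp_ker (hR : IsCoh R) {M N : Type u} [AddCommGroup M] [Module R M]
    [AddCommGroup N] [Module R N] [Module.FinitePresentation R M] [Module.FinitePresentation R N]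
    (f : M →ₗ[R] N) : Module.FinitePresentation R (LinearMap.ker f) := by
  have := fp_of_injective hR (LinearMap.range f).subtype Subtype.val_injective
  have : Module.Finite R (LinearMap.ker f) := by
    have h := Module.FinitePresentation.fg_ker f.rangeRestrict f.surjective_rangeRestrict
    rw [LinearMap.ker_rangeRestrict] at h
    exact Module.Finite.iff_fg.2 h
  exact fp_of_injective hR (LinearMap.ker f).subtype Subtype.val_injective

lemma fp_quotient (I : Ideal R) (hI : I.FG) : Module.FinitePresentation R (R ⧸ I) :=
  Module.finitePresentation_of_surjective (Submodule.mkQ I) (Submodule.mkQ_surjective _)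
    (by rwa [Submodule.ker_mkQ])

lemma fp_dual (hR : IsCoh R) (M : Type u) [AddCommGroup M] [Module R M]
    [Module.FinitePresentation R M] : Module.FinitePresentation R (Module.Dual R M) := by
  obtain ⟨n, g, hg⟩ := Module.Finite.exists_fin' R M
  have hk := fp_ker hR g
  obtain ⟨m, h, hh⟩ := Module.Finite.exists_fin' R (LinearMap.ker g)
  have he : Function.Exact ((LinearMap.ker g).subtype ∘ₗ h) g := by
    intro x
    constructor
    · intro hx
      obtain ⟨y, hy⟩ := hh ⟨x, hx⟩
      exact ⟨y, by simp [hy]⟩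
    · rintro ⟨y, rfl⟩
      simp
  have hi : Function.Injective g.dualMap := LinearMap.dualMap_injective_of_surjective hg
  have : ∀ k, Module.FinitePresentation R (Module.Dual R (Fin k → R)) := fun k =>
    Module.finitePresentation_of_projective _ _
  have := fp_ker hR ((LinearMap.ker g).subtype ∘ₗ h).dualMap
  exact Module.FinitePresentation.of_equiv
    (M := LinearMap.ker ((LinearMap.ker g).subtype ∘ₗ h).dualMap)
    (kerEquiv hi (exact_dualMap he hg)).symm

end Coherent

section GClass

variable {R : Type u} [CommRing R]

/-- The G-class, in terms of Yoneda `Ext`. -/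
structure MG (R : Type u) [CommRing R] (M : Type u) [AddCommGroup M] [Module R M] : Prop where
  finite : Module.Finite R M
  reflexive : Module.IsReflexive R M
  ext : ∀ i, Subsingleton (ExtGrp R M R (i + 1))
  ext_dual : ∀ i, Subsingleton (ExtGrp R (Module.Dual R M) R (i + 1))

variable {M N L P G F : Type u}
  [AddCommGroup M] [Module R M] [AddCommGroup N] [Module R N]
  [AddCommGroup L] [Module R L] [AddCommGroup P] [Module R P] [AddCommGroup G] [Module R G]
  [AddCommGroup F] [Module R F]

lemma memG_iff : MemG R (ModuleCat.of R M) ↔ MG R M := by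
  have aux : ∀ X : Type u, ∀ [AddCommGroup X] [Module R X],
      (∀ i > 0, extZero R (ModuleCat.of R X) (ModuleCat.of R R) i) ↔
      ∀ i, Subsingleton (ExtGrp R X R (i + 1)) := by
    intro X _ _
    constructor
    · intro h i; exact (extZero_iff X R i).1 (h _ i.succ_pos)
    · intro h i hi
      obtain ⟨j, rfl⟩ := Nat.exists_eq_add_one_of_ne_zero hi.ne'
      exact (extZero_iff X R j).2 (h j)
  constructor
  · rintro ⟨h1, h2, h3, h4⟩
    exact ⟨h1, h2, (aux _).1 h3, (aux _).1 h4⟩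
  · rintro ⟨h1, h2, h3, h4⟩
    exact ⟨h1, h2, (aux _).2 h3, (aux _).2 h4⟩

lemma MG.of_equiv (h : MG R M) (e : M ≃ₗ[R] N) : MG R N where
  finite := have := h.finite; Module.Finite.equiv e
  reflexive := have := h.reflexive; Module.equiv e
  ext i := have := h.ext i; subsingleton_ext_left e.symm
  ext_dual i := have := h.ext_dual i; subsingleton_ext_left e.dualMap

lemma MG.of_projective [Module.Finite R M] [Module.Projective R M] : MG R M where
  finite := inferInstance
  reflexive := inferInstance
  ext i := subsingleton_ext_of_projective i
  ext_dual i := subsingleton_ext_of_projective i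

lemma MG.dual (h : MG R M) (hfin : Module.Finite R (Module.Dual R M)) :
    MG R (Module.Dual R M) where
  finite := hfin
  reflexive := have := h.reflexive; inferInstance
  ext := h.ext_dual
  ext_dual i := have := h.reflexive; have := h.ext i
    subsingleton_ext_left (Module.evalEquiv R M).symm

lemma subsingleton_ext_prod {i : ℕ} (h1 : Subsingleton (ExtGrp R M R i))
    (h2 : Subsingleton (ExtGrp R N R i)) : Subsingleton (ExtGrp R (M × N) R i) :=
  subsingleton_pull_mid (f := LinearMap.inl R M N) (g := LinearMap.snd R M N)
    LinearMap.inl_injective Function.Exact.inl_snd LinearMap.snd_surjective h1 h2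

lemma MG.prod (h : MG R M) (h' : MG R N) : MG R (M × N) where
  finite := have := h.finite; have := h'.finite; inferInstance
  reflexive := have := h.reflexive; have := h'.reflexive; inferInstance
  ext i := subsingleton_ext_prod (h.ext i) (h'.ext i)
  ext_dual i := have := subsingleton_ext_prod (h.ext_dual i) (h'.ext_dual i)
    subsingleton_ext_left (Module.dualProdDualEquivDual R M N).symm

lemma MG.ker {f : L →ₗ[R] P} {g : P →ₗ[R] G} (hP : MG R P) (hG : MG R G)
    (hL : Module.Finite R L) (hf : Function.Injective f) (hfg : Function.Exact f g)
    (hg : Function.Surjective g) : MG R L := by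
  have := hP.reflexive
  have := hG.reflexive
  have hd := exact_dualMap hfg hg
  have hgd : Function.Injective g.dualMap := LinearMap.dualMap_injective_of_surjective hg
  have hfd : Function.Surjective f.dualMap := fun φ => exists_extension hf hfg hg (hG.ext 0) φ
  refine ⟨hL, ⟨?_, ?_⟩, fun i => subsingleton_pull_left hf hfg hg (hP.ext i) (hG.ext (i + 1)), ?_⟩
  · rw [injective_iff_map_eq_zero]
    intro x hx
    refine hf ((Module.bijective_dual_eval R P).1 ?_)
    ext ξ
    simpa using LinearMap.congr_fun hx (f.dualMap ξ)
  · intro l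
    obtain ⟨p, hp⟩ := (Module.bijective_dual_eval R P).2 (l ∘ₗ f.dualMap)
    have hp' : ∀ ζ, ζ p = l (f.dualMap ζ) := fun ζ => LinearMap.congr_fun hp ζ
    have hgp : g p = 0 := by
      refine (Module.bijective_dual_eval R G).1 ?_
      ext η
      have := hp' (g.dualMap η)
      rw [hd.apply_apply_eq_zero] at this
      simpa using this
    obtain ⟨x, rfl⟩ := (hfg p).1 hgp
    refine ⟨x, ?_⟩
    ext ξ
    obtain ⟨ζ, rfl⟩ := hfd ξ
    simpa using hp' ζ
  · rintro (_ | i)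
    · refine subsingleton_ext_one hgd hd hfd (hP.ext_dual 0) fun φ => ?_
      obtain ⟨x, rfl⟩ := (Module.bijective_dual_eval R G).2 φ
      obtain ⟨p, rfl⟩ := hg x
      exact ⟨Module.Dual.eval R P p, rfl⟩
    · refine subsingleton_pull_right hgd hd hfd (fun j hj => ?_) (hP.ext_dual (i + 1))
      obtain rfl : j = i + 1 := by omega
      exact hG.ext_dual i

lemma MG.coker {f : L →ₗ[R] F} {g : F →ₗ[R] M} (hL : MG R L) [Module.Finite R F]
    [Module.Projective R F] (hf : Function.Injective f) (hfg : Function.Exact f g)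
    (hg : Function.Surjective g) (hfd : Function.Surjective f.dualMap) : MG R M := by
  have hF : MG R F := .of_projective
  have := hL.reflexive
  have := hF.reflexive
  have hd := exact_dualMap hfg hg
  have hgd : Function.Injective g.dualMap := LinearMap.dualMap_injective_of_surjective hg
  refine ⟨Module.Finite.of_surjective g hg, ⟨?_, ?_⟩, ?_,
    fun i => subsingleton_pull_left hgd hd hfd (hF.ext_dual i) (hL.ext_dual (i + 1))⟩
  · rw [injective_iff_map_eq_zero]
    intro x hx
    obtain ⟨y, rfl⟩ := hg x
    obtain ⟨l, hl⟩ := exists_desc hd hfd (Module.Dual.eval R F y) (by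
      ext η; simpa using LinearMap.congr_fun hx η)
    obtain ⟨z, rfl⟩ := (Module.bijective_dual_eval R L).2 l
    have : f z = y := (Module.bijective_dual_eval R F).1 hl
    rw [← this, hfg.apply_apply_eq_zero]
  · intro l
    obtain ⟨m, hm⟩ := exists_extension hgd hd hfd (hL.ext_dual 0) l
    obtain ⟨y, rfl⟩ := (Module.bijective_dual_eval R F).2 m
    exact ⟨g y, hm⟩
  · rintro (_ | i)
    · exact subsingleton_ext_one hf hfg hg (hF.ext 0) hfd
    · refine subsingleton_pull_right hf hfg hg (fun j hj => ?_) (hF.ext (i + 1))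
      obtain rfl : j = i + 1 := by omega
      exact hL.ext i

/-- A finitely presented module in the G-class embeds in a finite free module with cokernel
again finitely presented and in the G-class. -/
lemma MG.exists_cosyzygy (hR : IsCoh R) [Module.FinitePresentation R M] (hM : MG R M) :
    ∃ (b : ℕ) (C : Type u) (_ : AddCommGroup C) (_ : Module R C) (f : M →ₗ[R] (Fin b → R))
      (g : (Fin b → R) →ₗ[R] C), Function.Injective f ∧ Function.Exact f g ∧
      Function.Surjective g ∧ MG R C ∧ Module.FinitePresentation R C := by
  have := hM.reflexive
  have hfpd := fp_dual hR M
  have hMd := hM.dual inferInstance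
  obtain ⟨b, p, hp⟩ := Module.Finite.exists_fin' R (Module.Dual R M)
  have hZ := fp_ker hR p
  have hZG : MG R (LinearMap.ker p) :=
    MG.ker MG.of_projective hMd inferInstance Subtype.val_injective (exact_subtype_ker p) hp
  have hfpZ := fp_dual hR (LinearMap.ker p)
  let e1 := Module.evalEquiv R M
  let e2 := (Pi.basisFun R (Fin b)).toDualEquiv
  have hex := exact_dualMap (exact_subtype_ker p) hp
  refine ⟨b, Module.Dual R (LinearMap.ker p), inferInstance, inferInstance,
    e2.symm.toLinearMap ∘ₗ p.dualMap ∘ₗ e1.toLinearMap,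
    (LinearMap.ker p).subtype.dualMap ∘ₗ e2.toLinearMap, ?_, ?_, ?_,
    hZG.dual inferInstance, hfpZ⟩
  · simpa using LinearMap.dualMap_injective_of_surjective hp
  · intro x
    have := hex (e2 x)
    rw [LinearMap.comp_apply, LinearEquiv.coe_coe, this]
    constructor
    · rintro ⟨y, hy⟩
      obtain ⟨z, rfl⟩ := e1.surjective y
      exact ⟨z, by simp [hy]⟩
    · rintro ⟨z, rfl⟩
      exact ⟨e1 z, by simp⟩
  · rw [LinearMap.coe_comp]
    refine Function.Surjective.comp (fun φ => ?_) e2.surjective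
    exact exists_extension Subtype.val_injective (exact_subtype_ker p) hp (hMd.ext 0) φ

end GClass

section GDimension

variable {R : Type u} [CommRing R] {M N L P G : Type u}
  [AddCommGroup M] [Module R M] [AddCommGroup N] [Module R N]
  [AddCommGroup L] [Module R L] [AddCommGroup P] [Module R P] [AddCommGroup G] [Module R G]

lemma gDimLe_zero_iff : GDimLe R 0 (ModuleCat.of R M) ↔ MG R M := memG_iff

lemma GDimLe.congr {n : ℕ} (h : GDimLe R n (ModuleCat.of R M)) (e : M ≃ₗ[R] N) :
    GDimLe R n (ModuleCat.of R N) := by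
  cases n with
  | zero => exact gDimLe_zero_iff.2 ((gDimLe_zero_iff.1 h).of_equiv e)
  | succ n =>
    obtain ⟨G, f, hG, hf, hk⟩ := h
    refine ⟨G, e.toLinearMap ∘ₗ f, hG, e.surjective.comp hf, ?_⟩
    have : LinearMap.ker (e.toLinearMap ∘ₗ f) = LinearMap.ker f := by
      ext; simp
    rw [this]
    exact hk

lemma GDimLe.of_exact {n : ℕ} {f : L →ₗ[R] G} {g : G →ₗ[R] M} (hG : MG R G)
    (hL : GDimLe R n (ModuleCat.of R L)) (hf : Function.Injective f) (hfg : Function.Exact f g)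
    (hg : Function.Surjective g) : GDimLe R (n + 1) (ModuleCat.of R M) :=
  ⟨ModuleCat.of R G, g, memG_iff.2 hG, hg, hL.congr (kerEquiv hf hfg)⟩

lemma GDimLe.exists_exact {n : ℕ} (h : GDimLe R (n + 1) (ModuleCat.of R M)) :
    ∃ (G : Type u) (_ : AddCommGroup G) (_ : Module R G) (g : G →ₗ[R] M), MG R G ∧
      Function.Surjective g ∧ GDimLe R n (ModuleCat.of R (LinearMap.ker g)) := by
  obtain ⟨G, g, hG, hg, hk⟩ := h
  exact ⟨G, inferInstance, inferInstance, g, memG_iff.1 hG, hg, hk⟩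

lemma GDimLe.finite {n : ℕ} (h : GDimLe R n (ModuleCat.of R M)) : Module.Finite R M := by
  cases n with
  | zero => exact (gDimLe_zero_iff.1 h).finite
  | succ n =>
    obtain ⟨G, _, _, g, hG, hg, -⟩ := h.exists_exact
    have := hG.finite
    exact Module.Finite.of_surjective g hg

lemma GDimLe.prod {n : ℕ} (h : GDimLe R n (ModuleCat.of R M)) (hN : MG R N) :
    GDimLe R n (ModuleCat.of R (M × N)) := by
  cases n with
  | zero => exact gDimLe_zero_iff.2 ((gDimLe_zero_iff.1 h).prod hN)
  | succ n =>
    obtain ⟨G, _, _, g, hG, hg, hk⟩ := h.exists_exact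
    refine GDimLe.of_exact (f := LinearMap.inl R G N ∘ₗ (LinearMap.ker g).subtype)
      (g := g.prodMap LinearMap.id) (hG.prod hN) hk ?_ ?_ ?_
    · exact LinearMap.inl_injective.comp Subtype.val_injective
    · rintro ⟨x, y⟩
      constructor
      · intro h
        have h1 : g x = 0 := congrArg Prod.fst h
        have h2 : y = 0 := congrArg Prod.snd h
        exact ⟨⟨x, h1⟩, by simp [h2]⟩
      · rintro ⟨⟨z, hz⟩, h⟩
        have hz' : g z = 0 := hz
        rw [← h]; simp [hz']
    · rintro ⟨x, y⟩
      obtain ⟨z, rfl⟩ := hg x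
      exact ⟨(z, y), rfl⟩

lemma GDimLe.ker {n : ℕ} {g : P →ₗ[R] G} (hP : GDimLe R n (ModuleCat.of R P)) (hG : MG R G)
    (hL : Module.Finite R (LinearMap.ker g)) (hg : Function.Surjective g) :
    GDimLe R n (ModuleCat.of R (LinearMap.ker g)) := by
  cases n with
  | zero => exact gDimLe_zero_iff.2 ((gDimLe_zero_iff.1 hP).ker hG hL Subtype.val_injective
      (exact_subtype_ker g) hg)
  | succ n =>
    obtain ⟨G₁, _, _, p, hG₁, hp, hk⟩ := hP.exists_exact
    have := hk.finite
    let q : LinearMap.ker (g ∘ₗ p) →ₗ[R] LinearMap.ker g := p.restrict fun _ hx => hx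
    let j : LinearMap.ker p →ₗ[R] LinearMap.ker (g ∘ₗ p) := Submodule.inclusion fun x hx => by
      have : p x = 0 := hx
      simp [this]
    have hj : Function.Injective j := Submodule.inclusion_injective _
    have hq : Function.Surjective q := by
      rintro ⟨y, hy⟩
      obtain ⟨x, rfl⟩ := hp y
      exact ⟨⟨x, hy⟩, rfl⟩
    have hjq : Function.Exact j q := by
      rintro ⟨x, hx⟩
      constructor
      · intro h; exact ⟨⟨x, congrArg Subtype.val h⟩, rfl⟩
      · rintro ⟨y, hy⟩
        have : p y = 0 := y.2
        rw [← hy]; exact Subtype.ext this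
    have hfin := finite_mid hjq hq
    exact GDimLe.of_exact (hG₁.ker hG hfin Subtype.val_injective (exact_subtype_ker (g ∘ₗ p))
      (hg.comp hp)) hk hj hjq hq

/-- Over any finitely generated projective cover, the syzygy of a module of G-dimension at most
`n + 1` has G-dimension at most `n`. -/
lemma GDimLe.syzygy {n : ℕ} (h : GDimLe R (n + 1) (ModuleCat.of R M)) [Module.Finite R P]
    [Module.Projective R P] {p : P →ₗ[R] M} (hp : Function.Surjective p)
    (hfin : Module.Finite R (LinearMap.ker p)) :
    GDimLe R n (ModuleCat.of R (LinearMap.ker p)) := by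
  obtain ⟨G, _, _, g, hG, hg, hk⟩ := h.exists_exact
  obtain ⟨s, hs⟩ := Module.projective_lifting_property g p hg
  have hs' : ∀ x, g (s x) = p x := LinearMap.congr_fun hs
  let q : LinearMap.ker g × P →ₗ[R] G := (LinearMap.ker g).subtype.coprod s
  have hq : Function.Surjective q := by
    intro y
    obtain ⟨x, hx⟩ := hp (g y)
    exact ⟨(⟨y - s x, by simp [hs', hx]⟩, x), by simp [q]⟩
  have hP : GDimLe R n (ModuleCat.of R (LinearMap.ker g × P)) := hk.prod MG.of_projective
  let j : LinearMap.ker p →ₗ[R] LinearMap.ker g × P :=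
    (LinearMap.codRestrict (LinearMap.ker g) (-(s ∘ₗ (LinearMap.ker p).subtype)) (by
      rintro ⟨x, hx⟩
      have hx' : p x = 0 := hx
      simp [hs', hx'])).prod (LinearMap.ker p).subtype
  have hj : Function.Injective j := fun x y h => Subtype.ext (congrArg Prod.snd h)
  have hjq : Function.Exact j q := by
    rintro ⟨⟨z, hz⟩, x⟩
    have hz' : g z = 0 := hz
    constructor
    · intro h
      have h' : z + s x = 0 := h
      have h'' : z = - s x := eq_neg_of_add_eq_zero_left h'
      refine ⟨⟨x, ?_⟩, ?_⟩
      · have := congrArg g h'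
        simpa [hz', hs'] using this
      · exact Prod.ext (Subtype.ext h''.symm) rfl
    · rintro ⟨w, hw⟩
      rw [← hw]
      simp [j, q]
  have e := kerEquiv hj hjq
  have hfin' : Module.Finite R (LinearMap.ker q) := Module.Finite.equiv e
  exact (hP.ker hG hfin' hq).congr e.symm

end GDimension

section BaseChange

variable {R : Type u} [CommRing R]

lemma solvable_iff_exact {a b c : ℕ} (f : (Fin a → R) →ₗ[R] (Fin b → R))
    (g : (Fin b → R) →ₗ[R] (Fin c → R)) (hgf : g ∘ₗ f = 0)
    (N : Type u) [AddCommGroup N] [Module R N] :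
    (∀ φ : (Fin b → R) →ₗ[R] N, φ ∘ₗ f = 0 → ∃ ψ : (Fin c → R) →ₗ[R] N, ψ ∘ₗ g = φ) ↔
      Function.Exact (g.dualMap.rTensor N) (f.dualMap.rTensor N) := by
  have hnat : ∀ {p q : ℕ} (h : (Fin p → R) →ₗ[R] (Fin q → R)),
      LinearMap.lcomp R N h ∘ₗ (dualTensorHomEquiv R (Fin q → R) N).toLinearMap =
        (dualTensorHomEquiv R (Fin p → R) N).toLinearMap ∘ₗ h.dualMap.rTensor N := by
    intro p q h
    refine TensorProduct.ext' fun x n => ?_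
    ext
    simp [dualTensorHomEquiv]
  rw [← Function.Exact.iff_of_ladder_linearEquiv (hnat g) (hnat f)]
  constructor
  · intro h φ
    constructor
    · intro h'
      exact h φ h'
    · rintro ⟨ψ, rfl⟩
      change (ψ ∘ₗ g) ∘ₗ f = 0
      rw [LinearMap.comp_assoc, hgf, LinearMap.comp_zero]
  · intro h φ h'
    exact (h φ).1 h'

lemma exists_presentation_ext (hR : IsCoh R) (i : ℕ) (T : Type u) [AddCommGroup T] [Module R T]
    [Module.FinitePresentation R T] :
    ∃ (a b c : ℕ) (f : (Fin a → R) →ₗ[R] (Fin b → R)) (g : (Fin b → R) →ₗ[R] (Fin c → R)),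
      g ∘ₗ f = 0 ∧ ∀ (N : Type u) [AddCommGroup N] [Module R N],
      Subsingleton (ExtGrp R T N i) ↔
      (∀ φ : (Fin b → R) →ₗ[R] N, φ ∘ₗ f = 0 → ∃ ψ : (Fin c → R) →ₗ[R] N, ψ ∘ₗ g = φ) := by
  have pres : ∀ (T : Type u) [AddCommGroup T] [Module R T] [Module.FinitePresentation R T],
      ∃ (a b : ℕ) (f : (Fin a → R) →ₗ[R] (Fin b → R)) (p : (Fin b → R) →ₗ[R] T),
        Function.Exact f p ∧ Function.Surjective p := by
    intro T _ _ _
    obtain ⟨b, p, hp⟩ := Module.Finite.exists_fin' R T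
    have := fp_ker hR p
    obtain ⟨a, h, hh⟩ := Module.Finite.exists_fin' R (LinearMap.ker p)
    refine ⟨a, b, (LinearMap.ker p).subtype ∘ₗ h, p, ?_, hp⟩
    rw [LinearMap.exact_iff, LinearMap.range_comp, LinearMap.range_eq_top.2 hh]
    simp
  induction i generalizing T with
  | zero =>
    obtain ⟨a, b, f, p, hfp, hp⟩ := pres T
    refine ⟨a, b, 0, f, 0, LinearMap.zero_comp _, fun N _ _ => ?_⟩
    rw [subsingleton_ext_zero_iff]
    constructor
    · intro h φ hφ
      obtain ⟨ψ, rfl⟩ := exists_desc hfp hp φ hφ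
      rw [Subsingleton.elim ψ 0]
      exact ⟨0, by simp⟩
    · intro h
      refine subsingleton_of_forall_eq 0 fun ψ => ?_
      obtain ⟨χ, hχ⟩ := h (ψ ∘ₗ p) (by rw [LinearMap.comp_assoc, hfp.linearMap_comp_eq_zero]; simp)
      ext t
      obtain ⟨x, rfl⟩ := hp t
      simpa using (LinearMap.congr_fun hχ x).symm
  | succ i ih =>
    obtain ⟨c, q, hq⟩ := Module.Finite.exists_fin' R T
    have hK := fp_ker hR q
    have hex := exact_subtype_ker q
    have hi : Function.Injective (LinearMap.ker q).subtype := Subtype.val_injective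
    cases i with
    | zero =>
      obtain ⟨a, b, f, p, hfp, hp⟩ := pres (LinearMap.ker q)
      refine ⟨a, b, c, f, (LinearMap.ker q).subtype ∘ₗ p, ?_, fun N _ _ => ?_⟩
      · rw [LinearMap.comp_assoc, hfp.linearMap_comp_eq_zero, LinearMap.comp_zero]
      constructor
      · intro h φ hφ
        obtain ⟨ψ, rfl⟩ := exists_desc hfp hp φ hφ
        obtain ⟨χ, rfl⟩ := exists_extension hi hex hq h ψ
        exact ⟨χ, rfl⟩
      · intro h
        refine subsingleton_ext_one hi hex hq (subsingleton_ext_of_projective 0) fun φ => ?_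
        obtain ⟨ψ, hψ⟩ := h (φ ∘ₗ p) (by
          rw [LinearMap.comp_assoc, hfp.linearMap_comp_eq_zero, LinearMap.comp_zero])
        refine ⟨ψ, ?_⟩
        ext t
        obtain ⟨x, rfl⟩ := hp t
        simpa using LinearMap.congr_fun hψ x
    | succ i =>
      obtain ⟨a, b, c, f, g, hgf, h⟩ := ih (LinearMap.ker q)
      refine ⟨a, b, c, f, g, hgf, fun N _ _ => ?_⟩
      rw [← h N]
      constructor
      · intro h'
        exact subsingleton_pull_left hi hex hq (subsingleton_ext_of_projective i) h'
      · intro h'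
        refine subsingleton_pull_right hi hex hq (fun j hj => ?_)
          (subsingleton_ext_of_projective (i + 1))
        obtain rfl : j = i + 1 := by omega
        exact h'

lemma lTensor_rTensor_exact_iff (A N : Type u) [AddCommGroup A] [Module R A] [AddCommGroup N]
    [Module R N] [Module.FaithfullyFlat R A] {P Q S : Type u} [AddCommGroup P] [Module R P]
    [AddCommGroup Q] [Module R Q] [AddCommGroup S] [Module R S] (g : P →ₗ[R] Q) (f : Q →ₗ[R] S) :
    Function.Exact ((g.rTensor N).lTensor A) ((f.rTensor N).lTensor A) ↔
      Function.Exact (g.rTensor N) (f.rTensor N) :=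
  Module.FaithfullyFlat.lTensor_exact_iff_exact R A (g.rTensor N) (f.rTensor N)

/-- Vanishing of `Ext` out of a finitely presented module over a coherent ring is insensitive to
tensoring the target with a faithfully flat module. -/
lemma subsingleton_ext_tensor_iff (hR : IsCoh R) (i : ℕ) (T : Type u) [AddCommGroup T] [Module R T]
    [Module.FinitePresentation R T] (A N : Type u) [AddCommGroup A] [Module R A]
    [AddCommGroup N] [Module R N] [Module.FaithfullyFlat R A] :
    Subsingleton (ExtGrp R T (A ⊗[R] N) i) ↔ Subsingleton (ExtGrp R T N i) := by
  obtain ⟨a, b, c, f, g, hgf, h⟩ := exists_presentation_ext hR i T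
  have hnat : ∀ {p q : ℕ} (h : (Fin p → R) →ₗ[R] (Fin q → R)),
      h.dualMap.rTensor (A ⊗[R] N) ∘ₗ
        (TensorProduct.leftComm R A (Module.Dual R (Fin q → R)) N).toLinearMap =
      (TensorProduct.leftComm R A (Module.Dual R (Fin p → R)) N).toLinearMap ∘ₗ
        (h.dualMap.rTensor N).lTensor A := by
    intro p q h
    refine TensorProduct.ext_threefold' fun x y z => ?_
    simp
  rw [h, h, solvable_iff_exact f g hgf, solvable_iff_exact f g hgf,
    Function.Exact.iff_of_ladder_linearEquiv (hnat g) (hnat f)]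
  exact lTensor_rTensor_exact_iff A N g.dualMap f.dualMap

end BaseChange

section RegularSequences

variable {R : Type u} [CommRing R]

lemma push_eq_zero_of_mem_map {S : Type u} [CommRing S] [Algebra R S] {T N : Type u}
    [AddCommGroup T] [Module R T] [AddCommGroup N] [Module R N] [Module S N] [IsScalarTower R S N]
    {I : Ideal R} (hT : ∀ r ∈ I, ∀ t : T, r • t = 0) {s : S} (hs : s ∈ I.map (algebraMap R S))
    {i : ℕ} (x : ExtGrp R T N i) :
    push ((LinearMap.lsmul S N s).restrictScalars R) x = 0 := by
  induction hs using Submodule.span_induction with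
  | mem s hs =>
    obtain ⟨r, hr, rfl⟩ := hs
    have : (LinearMap.lsmul S N (algebraMap R S r)).restrictScalars R =
        r • (LinearMap.id : N →ₗ[R] N) := by ext; simp
    rw [this, push_smul, push_id]
    exact smul_eq_zero_of_smul_left r (hT r hr) x
  | zero =>
    have : (LinearMap.lsmul S N (0 : S)).restrictScalars R = 0 := by ext; simp
    rw [this, push_zero]
  | add a b _ _ ha hb =>
    have : (LinearMap.lsmul S N (a + b)).restrictScalars R =
      (LinearMap.lsmul S N a).restrictScalars R + (LinearMap.lsmul S N b).restrictScalars R := by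
      ext; simp
    rw [this, push_add, ha, hb, add_zero]
  | smul a b _ hb =>
    have : (LinearMap.lsmul S N (a • b)).restrictScalars R =
      (LinearMap.lsmul S N a).restrictScalars R ∘ₗ (LinearMap.lsmul S N b).restrictScalars R := by
      ext; simp [smul_smul, mul_comm]
    rw [this, ← push_push, hb, map_zero]

/-- `Ext^i_R(R/I, N) = 0` for all `i < k`. -/
def ExtVanish (I : Ideal R) (N : Type u) [AddCommGroup N] [Module R N] (k : ℕ) : Prop :=
  ∀ i < k, Subsingleton (ExtGrp R (R ⧸ I) N i)

section

variable {S : Type u} [CommRing S] [Algebra R S] {N : Type u}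
    [AddCommGroup N] [Module R N] [Module S N] [IsScalarTower R S N]

open scoped Pointwise in
/-- The sequence `N → N → N / sN` for a nonzerodivisor `s`, over a smaller base ring. -/
lemma exact_smul_mkQ (s : S) :
    Function.Exact ((LinearMap.lsmul S N s).restrictScalars R)
      ((Submodule.mkQ (s • (⊤ : Submodule S N))).restrictScalars R) := by
  intro x
  simp only [LinearMap.restrictScalars_apply, Submodule.mkQ_apply, Submodule.Quotient.mk_eq_zero]
  constructor
  · rintro ⟨y, -, rfl⟩
    exact ⟨y, rfl⟩
  · rintro ⟨y, rfl⟩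
    exact ⟨y, trivial, rfl⟩

lemma surjective_mkQ_restrictScalars (P : Submodule S N) :
    Function.Surjective (P.mkQ.restrictScalars R) := fun y => by
  obtain ⟨x, rfl⟩ := P.mkQ_surjective y
  exact ⟨x, rfl⟩

lemma extVanish_of_isWeaklyRegular {I : Ideal R} {rs : List S}
    (hrs : ∀ r ∈ rs, r ∈ I.map (algebraMap R S))
    (h : RingTheory.Sequence.IsWeaklyRegular N rs) : ExtVanish I N rs.length := by
  induction rs generalizing N with
  | nil => exact fun i hi => absurd hi (Nat.not_lt_zero i)
  | cons s rs ih =>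
    rw [RingTheory.Sequence.isWeaklyRegular_cons_iff] at h
    have ih' := ih (fun r hr => hrs r (List.mem_cons_of_mem _ hr)) h.2
    intro i hi
    rw [List.length_cons] at hi
    have hinj : Function.Injective (push ((LinearMap.lsmul S N s).restrictScalars R) :
        ExtGrp R (R ⧸ I) N i →ₗ[R] ExtGrp R (R ⧸ I) N i) :=
      push_injective (C := QuotSMulTop s N) h.1 (exact_smul_mkQ s)
        (surjective_mkQ_restrictScalars _) (fun j hj => ih' j (by omega))
    refine subsingleton_of_forall_eq 0 fun x => hinj ?_
    rw [map_zero]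
    refine push_eq_zero_of_mem_map (I := I) (fun r hr t => ?_) (hrs s List.mem_cons_self) x
    obtain ⟨t, rfl⟩ := Ideal.Quotient.mk_surjective t
    rw [← Ideal.Quotient.mk_eq_mk, ← Submodule.Quotient.mk_smul, Submodule.Quotient.mk_eq_zero]
    exact I.mul_mem_right _ hr

/-- McCoy's argument: a polynomial whose coefficients have no common annihilated vector is
regular on the polynomial module. -/
lemma isSMulRegular_polynomialModule (f : Polynomial S)
    (h : ∀ n : N, (∀ j, f.coeff j • n = 0) → n = 0) :
    IsSMulRegular (PolynomialModule S N) f := by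
  have hc : ∀ (s : S) (p : PolynomialModule S N) (n : ℕ), (s • p).coeff n = s • p.coeff n :=
    fun _ _ _ => rfl
  have key : ∀ (d : ℕ) (p : PolynomialModule S N),
      (∀ n ≥ d, p.coeff n = 0) → f • p = 0 → p = 0 := by
    intro d
    induction d with
    | zero =>
      intro p hp _
      apply PolynomialModule.coeff_injective
      ext n
      exact hp n (Nat.zero_le n)
    | succ d ih =>
      intro p hp hfp
      have hz : ∀ (k i : ℕ), f.natDegree < i + k → f.coeff i • p = 0 := by
        intro k
        induction k using Nat.strong_induction_on with
        | _ k ihk =>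
        intro i hik
        by_cases hi : f.natDegree < i
        · rw [Polynomial.coeff_eq_zero_of_natDegree_lt hi, zero_smul]
        have hj : ∀ j > i, f.coeff j • p = 0 := fun j hj =>
          ihk (k - 1) (by omega) j (by omega)
        have hcoef : f.coeff i • p.coeff d = 0 := by
          have h1 := congrArg (fun q => q.coeff (i + d)) hfp
          simp only [PolynomialModule.smul_apply, PolynomialModule.coeff_zero,
            Finsupp.coe_zero, Pi.zero_apply] at h1
          rw [Finset.sum_eq_single (i, d)] at h1
          · exact h1
          · rintro ⟨a, b⟩ hab hne
            rw [Finset.HasAntidiagonal.mem_antidiagonal] at hab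
            simp only at hab ⊢
            rcases lt_trichotomy a i with ha | ha | ha
            · rw [hp b (by omega), smul_zero]
            · exact absurd (Prod.ext ha (by simp only; omega)) hne
            · have := congrArg (fun q => q.coeff b) (hj a ha)
              simpa [hc] using this
          · intro hn
            exact absurd (Finset.HasAntidiagonal.mem_antidiagonal.2 (show i + d = i + d from rfl)) hn
        apply ih
        · intro n hn
          rcases hn.eq_or_lt with rfl | hn
          · rw [hc, hcoef]
          · rw [hc, hp n hn, smul_zero]
        · rw [smul_comm, hfp, smul_zero]
      apply PolynomialModule.coeff_injective
      ext n
      refine h _ fun j => ?_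
      have := congrArg (fun q => q.coeff n) (hz (f.natDegree + 1) j (by omega))
      simpa [hc] using this
  rw [isSMulRegular_iff_right_eq_zero_of_smul]
  intro p hp
  obtain ⟨d, hd⟩ := p.coeff.support.exists_nat_subset_range
  refine key d p (fun n hn => ?_) hp
  by_contra hne
  have := hd (Finsupp.mem_support_iff.2 hne)
  rw [Finset.mem_range] at this
  omega

omit [Algebra R S] [IsScalarTower R S N] in
lemma subsingleton_ext_polynomialModule (hR : IsCoh R) [Nontrivial R] {i : ℕ} {T : Type u}
    [AddCommGroup T] [Module R T] [Module.FinitePresentation R T]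
    (h : Subsingleton (ExtGrp R T N i)) : Subsingleton (ExtGrp R T (PolynomialModule S N) i) := by
  have := (subsingleton_ext_tensor_iff hR i T (ℕ →₀ R) N).2 h
  let e : PolynomialModule S N ≃ₗ[R] (ℕ →₀ R) ⊗[R] N :=
    (PolynomialModule.coeffLinearEquiv S R).trans
      (TensorProduct.finsuppScalarLeft R N ℕ).symm
  exact subsingleton_ext_right (N := (ℕ →₀ R) ⊗[R] N) e.symm

end

end RegularSequences

section DepthTranslation

variable {R : Type u} [CommRing R]

lemma eq_zero_of_subsingleton_ext_zero {I : Ideal R} {N : Type u} [AddCommGroup N] [Module R N]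
    (h : Subsingleton (ExtGrp R (R ⧸ I) N 0)) (n : N) (hn : ∀ r ∈ I, r • n = 0) : n = 0 := by
  rw [subsingleton_ext_zero_iff] at h
  have := LinearMap.congr_fun (Subsingleton.elim
    (Submodule.liftQ I (LinearMap.toSpanSingleton R N n) (fun r hr => hn r hr)) 0)
    (Submodule.Quotient.mk (1 : R))
  exact (one_smul R n).symm.trans this

lemma ExtVanish.exists_isWeaklyRegular (hR : IsCoh R) [Nontrivial R] {I : Ideal R} (hI : I.FG)
    (k : ℕ) (S : Type u) [CommRing S] [Algebra R S] [Nontrivial S] (N : Type u) [AddCommGroup N]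
    [Module R N] [Module S N] [IsScalarTower R S N] (h : ExtVanish I N k) :
    ∃ (S' : Type u) (_ : CommRing S') (_ : Algebra S S') (rs : List S'),
      Module.FaithfullyFlat S S' ∧ rs.length = k ∧
      (∀ r ∈ rs, r ∈ (I.map (algebraMap R S)).map (algebraMap S S')) ∧
      RingTheory.Sequence.IsWeaklyRegular (S' ⊗[S] N) rs := by
  induction k generalizing S N with
  | zero =>
    exact ⟨S, inferInstance, inferInstance, [], inferInstance, rfl, by simp, by simp⟩
  | succ k ih =>
    obtain ⟨n, a, ha⟩ := Submodule.fg_iff_exists_fin_generating_family.1 hI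
    have hfp : Module.FinitePresentation R (R ⧸ I) := fp_quotient I hI
    let f : Polynomial S := ∑ j : Fin n, Polynomial.monomial (j : ℕ) (algebraMap R S (a j))
    have hfc : ∀ j : Fin n, f.coeff j = algebraMap R S (a j) := by
      intro j
      simp [f, Polynomial.coeff_monomial, Fin.val_inj]
    have hf : f ∈ (I.map (algebraMap R S)).map (algebraMap S (Polynomial S)) := by
      refine Submodule.sum_mem _ fun j _ => ?_
      rw [← Polynomial.C_mul_X_pow_eq_monomial]
      exact Ideal.mul_mem_right _ _ (Ideal.mem_map_of_mem _
        (Ideal.mem_map_of_mem _ (ha ▸ Submodule.subset_span ⟨j, rfl⟩)))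
    have hreg : IsSMulRegular (PolynomialModule S N) f := by
      refine isSMulRegular_polynomialModule f fun x hx => ?_
      refine eq_zero_of_subsingleton_ext_zero (h 0 (Nat.succ_pos k)) x fun r hr => ?_
      rw [← ha] at hr
      induction hr using Submodule.span_induction with
      | mem r hr =>
        obtain ⟨j, rfl⟩ := hr
        have := hx j
        rwa [hfc, algebraMap_smul] at this
      | zero => simp
      | add r s _ _ h1 h2 => rw [add_smul, h1, h2, add_zero]
      | smul r s _ h1 => rw [smul_assoc, h1, smul_zero]
    have hN : ExtVanish I (QuotSMulTop f (PolynomialModule S N)) k := fun i hi =>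
      subsingleton_push_right (f := (LinearMap.lsmul (Polynomial S)
          (PolynomialModule S N) f).restrictScalars R) hreg (exact_smul_mkQ f)
        (surjective_mkQ_restrictScalars _)
        (subsingleton_ext_polynomialModule hR (h i (by omega)))
        (subsingleton_ext_polynomialModule hR (h (i + 1) (by omega)))
    obtain ⟨S', _, _, rs, hff, hl, hrs, hw⟩ := ih (Polynomial S) _ hN
    let _ : Algebra S S' :=
      ((algebraMap (Polynomial S) S').comp (algebraMap S (Polynomial S))).toAlgebra
    have : IsScalarTower S (Polynomial S) S' := IsScalarTower.of_algebraMap_eq' rfl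
    have hmap : (I.map (algebraMap R S)).map (algebraMap S S') =
        ((I.map (algebraMap R S)).map (algebraMap S (Polynomial S))).map
          (algebraMap (Polynomial S) S') := by
      rw [Ideal.map_map (algebraMap S (Polynomial S)) (algebraMap (Polynomial S) S')]
      rfl
    have hR' : I.map (algebraMap R (Polynomial S)) =
        (I.map (algebraMap R S)).map (algebraMap S (Polynomial S)) := by
      rw [Ideal.map_map, ← IsScalarTower.algebraMap_eq]
    have hSP : Module.FaithfullyFlat S (Polynomial S) :=
      Module.FaithfullyFlat.of_linearEquiv _ _ (Polynomial.toFinsuppIsoLinear S)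
    refine ⟨S', inferInstance, inferInstance, algebraMap (Polynomial S) S' f :: rs,
      Module.FaithfullyFlat.trans S (Polynomial S) S', by simp [hl], ?_, ?_⟩
    · rw [hmap]
      intro r hr
      rcases List.mem_cons.1 hr with rfl | hr
      · exact Ideal.mem_map_of_mem _ hf
      · rw [← hR']
        exact hrs r hr
    · let e : S' ⊗[Polynomial S] PolynomialModule S N ≃ₗ[S'] S' ⊗[S] N :=
        (LinearEquiv.baseChange (Polynomial S) S' _ _
          (PolynomialModule.polynomialTensorProductLEquivPolynomialModule S N).symm).trans
          (TensorProduct.AlgebraTensorModule.cancelBaseChange S (Polynomial S) S' S' N)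
      rw [← e.isWeaklyRegular_congr, RingTheory.Sequence.isWeaklyRegular_cons_iff]
      refine ⟨hreg.of_flat_of_isBaseChange (TensorProduct.isBaseChange _ _ _), ?_⟩
      rwa [(QuotSMulTop.algebraMapTensorEquivTensorQuotSMulTop f
        (PolynomialModule S N) S').isWeaklyRegular_congr]

lemma exists_fg_mem_map {S : Type u} [CommRing S] [Algebra R S] {J : Ideal R} {s : S}
    (hs : s ∈ J.map (algebraMap R S)) :
    ∃ I : Ideal R, I.FG ∧ I ≤ J ∧ s ∈ I.map (algebraMap R S) := by
  induction hs using Submodule.span_induction with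
  | mem s hs =>
    obtain ⟨r, hr, rfl⟩ := hs
    exact ⟨Ideal.span {r}, ⟨{r}, by simp⟩, (Ideal.span_singleton_le_iff_mem J).2 hr,
      Ideal.mem_map_of_mem _ (Ideal.mem_span_singleton_self r)⟩
  | zero => exact ⟨⊥, Submodule.fg_bot, bot_le, zero_mem _⟩
  | add a b _ _ ha hb =>
    obtain ⟨I, hI, hIJ, h1⟩ := ha
    obtain ⟨I', hI', hIJ', h2⟩ := hb
    exact ⟨I ⊔ I', Submodule.FG.sup hI hI', sup_le hIJ hIJ', add_mem (Ideal.map_mono le_sup_left h1)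
      (Ideal.map_mono le_sup_right h2)⟩
  | smul a b _ hb =>
    obtain ⟨I, hI, hIJ, h1⟩ := hb
    exact ⟨I, hI, hIJ, Ideal.mul_mem_left _ a h1⟩

lemma exists_fg_forall_mem_map {S : Type u} [CommRing S] [Algebra R S] {J : Ideal R}
    (rs : List S) (hrs : ∀ s ∈ rs, s ∈ J.map (algebraMap R S)) :
    ∃ I : Ideal R, I.FG ∧ I ≤ J ∧ ∀ s ∈ rs, s ∈ I.map (algebraMap R S) := by
  induction rs with
  | nil => exact ⟨⊥, Submodule.fg_bot, bot_le, by simp⟩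
  | cons s rs ih =>
    obtain ⟨I, hI, hIJ, h1⟩ := ih fun s hs => hrs s (List.mem_cons_of_mem _ hs)
    obtain ⟨I', hI', hIJ', h2⟩ := exists_fg_mem_map (hrs s List.mem_cons_self)
    refine ⟨I ⊔ I', Submodule.FG.sup hI hI', sup_le hIJ hIJ', fun t ht => ?_⟩
    rcases List.mem_cons.1 ht with rfl | ht
    · exact Ideal.map_mono le_sup_right h2
    · exact Ideal.map_mono le_sup_left (h1 t ht)

variable [IsLocalRing R] {N : Type u} [AddCommGroup N] [Module R N]

lemma exists_extVanish_of_le_depth (hR : IsCoh R) {k : ℕ} (h : (k : ℕ∞) ≤ depth R N) :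
    ∃ I : Ideal R, I.FG ∧ I ≤ IsLocalRing.maximalIdeal R ∧ ExtVanish I N k := by
  cases k with
  | zero => exact ⟨⊥, Submodule.fg_bot, bot_le, fun i hi => absurd hi (Nat.not_lt_zero i)⟩
  | succ k =>
    have hk : (k : ℕ∞) < depth R N :=
      lt_of_lt_of_le (by exact_mod_cast Nat.lt_succ_self k) h
    obtain ⟨E, hE⟩ := lt_iSup_iff.1 hk
    obtain ⟨⟨rs, hrs, hreg⟩, hlt⟩ := lt_iSup_iff.1 hE
    have hlt : k < rs.length := by exact_mod_cast hlt
    obtain ⟨I, hI, hIm, hrs⟩ := exists_fg_forall_mem_map rs hrs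
    have := E.faithfullyFlat
    have hfp := fp_quotient I hI
    have hv := extVanish_of_isWeaklyRegular hrs hreg.1
    exact ⟨I, hI, hIm, fun i hi => (subsingleton_ext_tensor_iff hR i (R ⧸ I) E.S N).1
      (hv i (by omega))⟩

lemma ExtVanish.le_depth (hR : IsCoh R) [Module.Finite R N] [Nontrivial N] {k : ℕ} {I : Ideal R}
    (hI : I.FG) (hIm : I ≤ IsLocalRing.maximalIdeal R) (h : ExtVanish I N k) :
    (k : ℕ∞) ≤ depth R N := by
  obtain ⟨S, _, _, rs, hff, rfl, hrs, hw⟩ := h.exists_isWeaklyRegular hR hI k R N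
  have hrs' : ∀ r ∈ rs, r ∈ (IsLocalRing.maximalIdeal R).map (algebraMap R S) := by
    intro r hr
    have := hrs r hr
    rw [Algebra.algebraMap_self, Ideal.map_id] at this
    exact Ideal.map_mono hIm this
  have hm : IsLocalRing.maximalIdeal R • (⊤ : Submodule R N) ≠ ⊤ := by
    intro heq
    refine top_ne_bot (α := Submodule R N) ?_
    refine Submodule.eq_bot_of_le_smul_of_le_jacobson_bot (IsLocalRing.maximalIdeal R) ⊤
      Module.Finite.fg_top heq.ge ?_
    rw [IsLocalRing.jacobson_eq_maximalIdeal ⊥ bot_ne_top]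
  have hreg : RingTheory.Sequence.IsRegular (S ⊗[R] N) rs := by
    refine ⟨hw, fun heq => ?_⟩
    refine ((TensorProduct.isBaseChange R N S).map_smul_top_ne_top_iff_of_faithfullyFlat
      R N (IsLocalRing.maximalIdeal R)).2 hm ?_
    refine top_le_iff.1 (heq.le.trans (Submodule.smul_mono_left ?_))
    rw [Ideal.ofList, Ideal.span_le]
    exact hrs'
  exact le_iSup_of_le (⟨S, hff⟩ : FFExt R) (le_iSup_of_le ⟨rs, hrs', hreg⟩ le_rfl)

end DepthTranslation

section Formula

variable {R : Type u} [CommRing R]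

lemma MG.subsingleton_ext (hR : IsCoh R) {T : Type u} [AddCommGroup T] [Module R T] (i : ℕ)
    (h : ∀ j ≤ i, Subsingleton (ExtGrp R T R j)) (M : Type u) [AddCommGroup M] [Module R M]
    [Module.FinitePresentation R M] (hM : MG R M) : Subsingleton (ExtGrp R T M i) := by
  induction i generalizing M with
  | zero =>
    obtain ⟨b, C, _, _, f, g, hf, hfg, hg, -, -⟩ := hM.exists_cosyzygy hR
    have := h 0 le_rfl
    exact subsingleton_push_left hf hfg hg (by simp) (subsingleton_ext_pi_right b)
  | succ i ih =>
    obtain ⟨b, C, _, _, f, g, hf, hfg, hg, hC, _⟩ := hM.exists_cosyzygy hR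
    have := h (i + 1) le_rfl
    refine subsingleton_push_left hf hfg hg (fun j hj => ?_) (subsingleton_ext_pi_right b)
    obtain rfl : j = i := by omega
    exact ih (fun j hj => h j (by omega)) C hC

lemma GDimLe.extVanish (hR : IsCoh R) {I : Ideal R} {k : ℕ} (h : ExtVanish I R k) (g : ℕ)
    (M : Type u) [AddCommGroup M] [Module R M] [Module.FinitePresentation R M]
    (hM : GDimLe R g (ModuleCat.of R M)) : ExtVanish I M (k - g) := by
  induction g generalizing M with
  | zero =>
    exact fun i hi => MG.subsingleton_ext hR i (fun j hj => h j (by omega)) M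
      (gDimLe_zero_iff.1 hM)
  | succ g ih =>
    obtain ⟨n, p, hp⟩ := Module.Finite.exists_fin' R M
    have hfp := fp_ker hR p
    have hL := ih _ (hM.syzygy hp inferInstance)
    intro i hi
    have := h i (by omega)
    exact subsingleton_push_right Subtype.val_injective (exact_subtype_ker p) hp
      (subsingleton_ext_pi_right n) (hL (i + 1) (by omega))

/-- `Ext` vanishing against `R ⧸ I` passes to all finitely presented modules killed by `I`. -/
lemma ExtVanish.subsingleton_of_smul_eq_zero (hR : IsCoh R) {I : Ideal R} (hI : I.FG) {N : Type u}
    [AddCommGroup N] [Module R N] {k : ℕ} (h : ExtVanish I N k) (i : ℕ) (hi : i < k) (K : Type u)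
    [AddCommGroup K] [Module R K] [Module.FinitePresentation R K]
    (hK : ∀ r ∈ I, ∀ x : K, r • x = 0) : Subsingleton (ExtGrp R K N i) := by
  induction i using Nat.strong_induction_on generalizing K with
  | _ i ih =>
  obtain ⟨n, p, hp⟩ := Module.Finite.exists_fin' R K
  have hfpI := fp_quotient I hI
  let q : (Fin n → R ⧸ I) →ₗ[R] K := ∑ j, (Submodule.liftQ I
    (LinearMap.toSpanSingleton R K (p (Pi.single j 1))) fun r hr => hK r hr _) ∘ₗ LinearMap.proj j
  have hqp : ∀ v : Fin n → R, q (fun j => Submodule.Quotient.mk (v j)) = p v := by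
    intro v
    rw [LinearMap.pi_apply_eq_sum_univ p v]
    simp only [q, LinearMap.coe_sum, Finset.sum_apply]
    refine Finset.sum_congr rfl fun j _ => ?_
    change v j • p (Pi.single j 1) = _
    congr 2
    ext l
    simp [Pi.single_apply, eq_comm]
  have hq : Function.Surjective q := fun x => by
    obtain ⟨v, rfl⟩ := hp x
    exact ⟨_, hqp v⟩
  have hfp := fp_ker hR q
  have := h i hi
  refine subsingleton_pull_right Subtype.val_injective (exact_subtype_ker q) hq (fun j hj => ?_)
    (subsingleton_ext_pi_left n)
  refine ih j (by omega) (by omega) _ fun r hr x => ?_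
  refine Subtype.ext (funext fun l => ?_)
  change r • (x : Fin n → R ⧸ I) l = 0
  obtain ⟨t, ht⟩ := Ideal.Quotient.mk_surjective ((x : Fin n → R ⧸ I) l)
  rw [← ht, ← Ideal.Quotient.mk_eq_mk, ← Submodule.Quotient.mk_smul,
    Submodule.Quotient.mk_eq_zero]
  exact I.mul_mem_right _ hr

lemma ExtVanish.of_le (hR : IsCoh R) {I J : Ideal R} (hI : I.FG) (hJ : J.FG) (hIJ : I ≤ J)
    {N : Type u} [AddCommGroup N] [Module R N] {k : ℕ} (h : ExtVanish I N k) : ExtVanish J N k := by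
  have := fp_quotient J hJ
  refine fun i hi => h.subsingleton_of_smul_eq_zero hR hI i hi _ fun r hr x => ?_
  obtain ⟨t, rfl⟩ := Ideal.Quotient.mk_surjective x
  rw [← Ideal.Quotient.mk_eq_mk, ← Submodule.Quotient.mk_smul, Submodule.Quotient.mk_eq_zero]
  exact J.mul_mem_right _ (hIJ hr)

lemma eq_zero_of_push_proj_eq_zero {T : Type u} [AddCommGroup T] [Module R T] {i b : ℕ}
    (x : ExtGrp R T (Fin b → R) i)
    (h : ∀ j, push (LinearMap.proj j : (Fin b → R) →ₗ[R] R) x = 0) : x = 0 := by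
  have hid : (LinearMap.id : (Fin b → R) →ₗ[R] (Fin b → R)) =
      ∑ j, LinearMap.single R (fun _ : Fin b => R) j ∘ₗ LinearMap.proj j := by
    ext j l
    simp [Pi.single_apply]
  rw [← push_id x, hid, push_sum]
  refine Finset.sum_eq_zero fun j _ => ?_
  rw [← push_push, h, map_zero]

/-- For `L` in the G-class, every linear map `L* → Ext^d(T, R)` is evaluation of an element of
`Ext^d(T, L)`, provided `Ext^j(T, R) = 0` for `j < d`. -/
lemma MG.exists_push_eq (hR : IsCoh R) {T : Type u} [AddCommGroup T] [Module R T] (d : ℕ)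
    (h : ∀ j < d, Subsingleton (ExtGrp R T R j)) {L : Type u} [AddCommGroup L] [Module R L]
    [Module.FinitePresentation R L] (hL : MG R L) (φ : Module.Dual R L →ₗ[R] ExtGrp R T R d) :
    ∃ u : ExtGrp R T L d, ∀ ξ : Module.Dual R L, push ξ u = φ ξ := by
  obtain ⟨b, C, _, _, ι, π, hι, hιπ, hπ, hC, _⟩ := hL.exists_cosyzygy hR
  obtain ⟨b', C', _, _, ι', π', hι', hιπ', hπ', hC', _⟩ := hC.exists_cosyzygy hR
  let w : ExtGrp R T (Fin b → R) d := ∑ j, push (LinearMap.single R (fun _ : Fin b => R) j)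
    (φ (LinearMap.proj j ∘ₗ ι))
  have hw : ∀ r : (Fin b → R) →ₗ[R] R, push r w = φ (r ∘ₗ ι) := by
    intro r
    have hr : r ∘ₗ ι = ∑ j, r (Pi.single j 1) • (LinearMap.proj j ∘ₗ ι : L →ₗ[R] R) := by
      ext x
      simp only [LinearMap.comp_apply, LinearMap.coe_sum, Finset.sum_apply, LinearMap.smul_apply,
        LinearMap.proj_apply, smul_eq_mul]
      rw [LinearMap.pi_apply_eq_sum_univ r]
      refine Finset.sum_congr rfl fun j _ => ?_
      rw [smul_eq_mul, mul_comm]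
      congr 2
      ext l
      simp [Pi.single_apply, eq_comm]
    rw [hr, map_sum, map_sum]
    refine Finset.sum_congr rfl fun j _ => ?_
    have : r ∘ₗ LinearMap.single R (fun _ : Fin b => R) j =
        r (Pi.single j 1) • (LinearMap.id : R →ₗ[R] R) := by
      ext
      simp
    rw [push_push, this, push_smul, push_id, map_smul]
  have hz : push π w = 0 := by
    refine push_injective hι' hιπ' hπ' (fun j hj => MG.subsingleton_ext hR j
      (fun l hl => h l (by omega)) C' hC') ?_
    rw [map_zero]
    refine eq_zero_of_push_proj_eq_zero _ fun j => ?_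
    rw [push_push, push_push, hw, LinearMap.comp_assoc, LinearMap.comp_assoc,
      hιπ.linearMap_comp_eq_zero, LinearMap.comp_zero, LinearMap.comp_zero, map_zero]
  obtain ⟨u, hu⟩ := AB.exists_push_eq hι hιπ hπ w hz
  refine ⟨u, fun ξ => ?_⟩
  obtain ⟨r, rfl⟩ := exists_extension hι hιπ hπ (hC.ext 0) ξ
  rw [← push_push, hu, hw]

lemma exists_gDim_eq {M : ModuleCat.{u} R} (h : GDim R M ≠ ⊤) :
    ∃ g : ℕ, GDim R M = g ∧ GDimLe R g M ∧ ∀ n < g, ¬ GDimLe R n M := by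
  classical
  have hex : ∃ g, GDimLe R g M := by
    by_contra! hn
    refine h (sInf_eq_top.2 ?_)
    rintro _ ⟨m, -, hm⟩
    exact absurd hm (hn m)
  refine ⟨Nat.find hex, le_antisymm (sInf_le ⟨_, rfl, Nat.find_spec hex⟩) (le_sInf ?_),
    Nat.find_spec hex, fun n => Nat.find_min hex⟩
  rintro _ ⟨m, rfl, hm⟩
  exact_mod_cast Nat.find_min' hex hm

variable [IsLocalRing R]

/-- A nonzero finitely presented module over a local ring surjects onto a nonzero finitely
presented cyclic module. -/
lemma exists_surjective_quotient (E : Type u) [AddCommGroup E] [Module R E]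
    [Module.FinitePresentation R E] [Nontrivial E] :
    ∃ (J : Ideal R) (π : E →ₗ[R] R ⧸ J), J.FG ∧ J ≤ IsLocalRing.maximalIdeal R ∧
      Function.Surjective π := by
  obtain ⟨n, p, hp⟩ := Module.Finite.exists_fin' R E
  have hfg := Module.FinitePresentation.fg_ker p hp
  obtain ⟨N, hN, -⟩ := (eq_top_or_exists_le_coatom (⊥ : Submodule R E)).resolve_left bot_ne_top
  have hs : IsSimpleModule R (E ⧸ N) := isSimpleModule_iff_isCoatom.2 hN
  obtain ⟨m, hm, ⟨e⟩⟩ := isSimpleModule_iff_quot_maximal.1 hs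
  obtain rfl := IsLocalRing.eq_maximalIdeal hm
  obtain ⟨l, hl⟩ := Module.projective_lifting_property
    (Submodule.mkQ (IsLocalRing.maximalIdeal R)) (e.toLinearMap ∘ₗ N.mkQ ∘ₗ p)
    (Submodule.mkQ_surjective _)
  have hls : Function.Surjective l := by
    obtain ⟨y, hy⟩ := (e.surjective.comp (N.mkQ_surjective.comp hp)) (Submodule.Quotient.mk 1)
    have h1 : (Submodule.Quotient.mk (l y) : R ⧸ IsLocalRing.maximalIdeal R) =
      Submodule.Quotient.mk 1 := (LinearMap.congr_fun hl y).trans hy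
    have hu : IsUnit (l y) := by
      by_contra hn
      have h2 : l y ∈ IsLocalRing.maximalIdeal R := hn
      rw [(Submodule.Quotient.mk_eq_zero _).2 h2, eq_comm, Submodule.Quotient.mk_eq_zero] at h1
      exact (Ideal.ne_top_iff_one _).1 hm.ne_top h1
    obtain ⟨v, hv⟩ := hu
    intro r
    refine ⟨(r * (v⁻¹ : Rˣ)) • y, ?_⟩
    rw [map_smul, ← hv, smul_eq_mul, mul_assoc, Units.inv_mul, mul_one]
  let J : Ideal R := (LinearMap.ker p).map l
  obtain ⟨π, hπ⟩ := exists_desc (exact_subtype_ker p) hp (Submodule.mkQ J ∘ₗ l) (by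
    ext x
    exact (Submodule.Quotient.mk_eq_zero _).2 (Submodule.mem_map_of_mem x.2))
  refine ⟨J, π, hfg.map l, ?_, ?_⟩
  · rintro _ ⟨x, hx, rfl⟩
    have hx : p x = 0 := hx
    have h1 := LinearMap.congr_fun hl x
    simp only [LinearMap.comp_apply, hx, map_zero] at h1
    exact (Submodule.Quotient.mk_eq_zero _).1 h1
  · have : Function.Surjective (π ∘ₗ p) := by
      rw [hπ]
      exact J.mkQ_surjective.comp hls
    exact Function.Surjective.of_comp this

lemma ExtVanish.exists_succ (hR : IsCoh R) {I : Ideal R} (hI : I.FG)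
    (hIm : I ≤ IsLocalRing.maximalIdeal R) {N : Type u} [AddCommGroup N] [Module R N] {d : ℕ}
    (h : ExtVanish I N d) (E : Type u) [AddCommGroup E] [Module R E]
    [Module.FinitePresentation R E] [Nontrivial E]
    (hE : ∀ φ : E →ₗ[R] ExtGrp R (R ⧸ I) N d, φ = 0) :
    ∃ J : Ideal R, J.FG ∧ J ≤ IsLocalRing.maximalIdeal R ∧ ExtVanish J N (d + 1) := by
  obtain ⟨J, π, hJ, hJm, hπ⟩ := exists_surjective_quotient (R := R) E
  have hV : ∀ v : ExtGrp R (R ⧸ I) N d, (∀ r ∈ J, r • v = 0) → v = 0 := by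
    intro v hv
    obtain ⟨x, hx⟩ := hπ (Submodule.Quotient.mk 1)
    have := LinearMap.congr_fun (hE (Submodule.liftQ J (LinearMap.toSpanSingleton R _ v)
      (fun r hr => hv r hr) ∘ₗ π)) x
    rw [LinearMap.comp_apply, hx] at this
    exact (one_smul R v).symm.trans this
  have hIJ : (I ⊔ J).FG := Submodule.FG.sup hI hJ
  refine ⟨I ⊔ J, hIJ, sup_le hIm hJm, fun i hi => ?_⟩
  have := fp_quotient I hI
  have := fp_quotient (I ⊔ J) hIJ
  let p : (R ⧸ I) →ₗ[R] R ⧸ (I ⊔ J) := Submodule.factor le_sup_left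
  have hp : Function.Surjective p := Submodule.factor_surjective le_sup_left
  have hK := fp_ker hR p
  have hkill : ∀ (J' : Ideal R), ∀ r ∈ J', ∀ x : R ⧸ J', r • x = 0 := by
    intro J' r hr x
    obtain ⟨t, rfl⟩ := Ideal.Quotient.mk_surjective x
    rw [← Ideal.Quotient.mk_eq_mk, ← Submodule.Quotient.mk_smul, Submodule.Quotient.mk_eq_zero]
    exact J'.mul_mem_right _ hr
  have hinj := pull_injective (N := N) (i := i) Subtype.val_injective (exact_subtype_ker p) hp
    (fun j hj => h.subsingleton_of_smul_eq_zero hR hI j (by omega) (LinearMap.ker p)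
      fun r hr x => Subtype.ext (hkill I r hr x))
  rcases Nat.lt_succ_iff_lt_or_eq.1 hi with hi | rfl
  · have := h i hi
    exact hinj.subsingleton
  · refine subsingleton_of_forall_eq 0 fun x => hinj ?_
    rw [map_zero]
    refine hV _ fun r hr => ?_
    rw [← map_smul, smul_eq_zero_of_smul_left r
      (hkill (I ⊔ J) r (le_sup_right (a := I) hr)) x, map_zero]

lemma ExtVanish.add_le (hR : IsCoh R) {d : ℕ}
    (hd : ∀ J : Ideal R, J.FG → J ≤ IsLocalRing.maximalIdeal R → ¬ ExtVanish J R (d + 1))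
    {I : Ideal R} (hI : I.FG) (hIm : I ≤ IsLocalRing.maximalIdeal R) (hId : ExtVanish I R d)
    (g : ℕ) (M : Type u) [AddCommGroup M] [Module R M] [Module.FinitePresentation R M]
    [Nontrivial M] (hM : GDimLe R g (ModuleCat.of R M))
    (hg : ∀ n < g, ¬ GDimLe R n (ModuleCat.of R M)) {e : ℕ} (h : ExtVanish I M e) :
    e + g ≤ d := by
  have key : ∀ (E : Type u) [AddCommGroup E] [Module R E] [Module.FinitePresentation R E],
      (∀ φ : E →ₗ[R] ExtGrp R (R ⧸ I) R d, φ = 0) → Subsingleton E := by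
    intro E _ _ _ hE
    rw [← not_nontrivial_iff_subsingleton]
    intro _
    obtain ⟨J, hJ, hJm, hv⟩ := hId.exists_succ hR hI hIm E hE
    exact hd J hJ hJm hv
  induction g generalizing M e with
  | zero =>
    by_contra hlt
    have hMG := gDimLe_zero_iff.1 hM
    have hsub := h d (by omega)
    have := fp_dual hR M
    have := key (Module.Dual R M) fun φ => by
      obtain ⟨u, hu⟩ := hMG.exists_push_eq hR d hId φ
      ext ξ
      rw [← hu, Subsingleton.elim u 0, map_zero, LinearMap.zero_apply]
    have := hMG.reflexive
    have := (Module.evalEquiv R M).toEquiv.subsingleton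
    exact not_subsingleton M this
  | succ g ih =>
    obtain ⟨n, p, hp⟩ := Module.Finite.exists_fin' R M
    have hfp := fp_ker hR p
    have hL : GDimLe R g (ModuleCat.of R (LinearMap.ker p)) := hM.syzygy hp inferInstance
    have hi : Function.Injective (LinearMap.ker p).subtype := Subtype.val_injective
    have hex := exact_subtype_ker p
    cases g with
    | zero =>
      by_contra hlt
      have hMG := gDimLe_zero_iff.1 hL
      have := fp_dual hR (LinearMap.ker p)
      let D := (LinearMap.ker p).subtype.dualMap
      have hfpE : Module.FinitePresentation R (Module.Dual R (LinearMap.ker p) ⧸ LinearMap.range D) :=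
        Module.finitePresentation_of_surjective (LinearMap.range D).mkQ
          (Submodule.mkQ_surjective _) (by
            rw [Submodule.ker_mkQ]
            exact Module.Finite.iff_fg.1 inferInstance)
      have hsub := key (Module.Dual R (LinearMap.ker p) ⧸ LinearMap.range D) fun φ => by
        obtain ⟨u, hu⟩ := hMG.exists_push_eq hR d hId (φ ∘ₗ (LinearMap.range D).mkQ)
        have hz : push (LinearMap.ker p).subtype u = 0 := by
          refine eq_zero_of_push_proj_eq_zero _ fun j => ?_
          rw [push_push, hu]
          have hm : (LinearMap.proj j : (Fin n → R) →ₗ[R] R) ∘ₗ (LinearMap.ker p).subtype ∈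
            LinearMap.range D := ⟨LinearMap.proj j, rfl⟩
          rw [LinearMap.comp_apply, Submodule.mkQ_apply, (Submodule.Quotient.mk_eq_zero _).2 hm,
            map_zero]
        have hu0 : u = 0 := by
          refine push_injective hi hex hp (fun j hj => h j (by omega)) ?_
          rw [hz, map_zero]
        refine LinearMap.ext fun x => ?_
        obtain ⟨ξ, rfl⟩ := (LinearMap.range D).mkQ_surjective x
        rw [← LinearMap.comp_apply, ← hu, hu0, map_zero, LinearMap.zero_apply]
      rw [Submodule.Quotient.subsingleton_iff, LinearMap.range_eq_top] at hsub
      exact hg 0 (by omega) (gDimLe_zero_iff.2 (hMG.coker hi hex hp hsub))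
    | succ g =>
      have hnt : Nontrivial (LinearMap.ker p) := by
        rw [← not_subsingleton_iff_nontrivial]
        intro _
        exact hg 1 (by omega) (GDimLe.of_exact .of_projective
          (gDimLe_zero_iff.2 .of_projective) hi hex hp)
      have := ih (LinearMap.ker p) hL (fun n hn hL' => hg (n + 1) (by omega)
        (GDimLe.of_exact .of_projective hL' hi hex hp)) (e := min (e + 1) d) (fun i hi' => by
          have := hId i (by omega)
          exact subsingleton_push_left hi hex hp (fun j hj => h j (by omega))
            (subsingleton_ext_pi_right n))
      omega

end Formula

end AB

/-- the Auslander-Bridger formula for coherent quasi-local rings -/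
theorem auslander_bridger (R : Type u) [CommRing R] [IsLocalRing R]
    (hcoh : ∀ I : Ideal R, I.FG → Module.FinitePresentation R I)
    (M : Type u) [AddCommGroup M] [Module R M] [Module.FinitePresentation R M]
    (hM0 : Nontrivial M) (hfin : AB.GDim R (ModuleCat.of R M) ≠ ⊤) :
    AB.depth R M + AB.GDim R (ModuleCat.of R M) = AB.depth R R := by
  obtain ⟨g, hgd, hg, hmin⟩ := AB.exists_gDim_eq hfin
  rw [hgd]
  have lower : ∀ k : ℕ, (k : ℕ∞) ≤ AB.depth R R → ((k - g : ℕ) : ℕ∞) ≤ AB.depth R M := by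
    intro k hk
    obtain ⟨I, hI, hIm, hv⟩ := AB.exists_extVanish_of_le_depth hcoh hk
    exact (AB.GDimLe.extVanish hcoh hv g M hg).le_depth hcoh hI hIm
  by_cases htop : AB.depth R R = ⊤
  · have : AB.depth R M = ⊤ := by
      refine ENat.eq_top_iff_forall_ge.2 fun k => ?_
      simpa using lower (k + g) (htop ▸ le_top)
    rw [this, htop, top_add]
  · obtain ⟨d, hd⟩ := ENat.ne_top_iff_exists.1 htop
    rw [← hd] at lower ⊢
    obtain ⟨I, hI, hIm, hv⟩ := AB.exists_extVanish_of_le_depth hcoh hd.le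
    have upper : ∀ k : ℕ, (k : ℕ∞) ≤ AB.depth R M → k + g ≤ d := by
      intro k hk
      obtain ⟨J, hJ, hJm, hw⟩ := AB.exists_extVanish_of_le_depth hcoh hk
      have hIJ : (I ⊔ J).FG := Submodule.FG.sup hI hJ
      refine AB.ExtVanish.add_le hcoh (fun J' hJ' hJm' hv' => ?_) hIJ (sup_le hIm hJm)
        (hv.of_le hcoh hI hIJ le_sup_left) g M hg hmin (hw.of_le hcoh hJ hIJ le_sup_right)
      have := hv'.le_depth hcoh hJ' hJm'
      rw [← hd] at this
      have : d + 1 ≤ d := by exact_mod_cast this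
      omega
    have hMtop : AB.depth R M ≠ ⊤ := fun htop' => by
      have := upper (d + 1) (htop' ▸ le_top)
      omega
    obtain ⟨e, he⟩ := ENat.ne_top_iff_exists.1 hMtop
    rw [← he] at lower upper ⊢
    have h1 := upper e le_rfl
    have h2 : d - g ≤ e := by exact_mod_cast lower d le_rfl
    have : e + g = d := by omega
    exact_mod_cast this
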